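/- arXiv:2409.17962 — 13 statements merged into one kernel-verified Lean document; each statement's English description precedes it below -/
import Mathlib

section
/- Let μ ∈ ℝ and let φ : ℝ → ℝ be strictly convex on ℝ and differentiable on (μ, ∞). Fix v1 < μ. Then the function v2 ↦ f(v1, v2) is strictly increasing on (μ, ∞): its derivative with respect to v2 is strictly positive for every v2 > μ. If in addition φ(x)/x → ∞ as x → ∞, then f(v1, v2) → ∞ as v2 → ∞. -/
open Filter

/-- For fixed `v1 < μ`, the function
`v2 ↦ f(v1,v2) = ((v2-μ)/(v2-v1))·φ(v1) + ((μ-v1)/(v2-v1))·φ(v2)` has strictly positive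
derivative on `(μ,∞)`, is strictly increasing there, and tends to infinity if
`φ(x)/x → ∞` as `x → ∞`. -/
theorem stmt1 (μ v1 : ℝ) (φ : ℝ → ℝ)
    (hconv : StrictConvexOn ℝ Set.univ φ)
    (hdiff : ∀ x ∈ Set.Ioi μ, DifferentiableAt ℝ φ x)
    (hv1 : v1 < μ) :
    (∀ v2 ∈ Set.Ioi μ,
      0 < deriv (fun v => (v - μ) / (v - v1) * φ v1 + (μ - v1) / (v - v1) * φ v) v2) ∧
    StrictMonoOn (fun v2 => (v2 - μ) / (v2 - v1) * φ v1 + (μ - v1) / (v2 - v1) * φ v2)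
      (Set.Ioi μ) ∧
    (Tendsto (fun x => φ x / x) atTop atTop →
      Tendsto (fun v2 => (v2 - μ) / (v2 - v1) * φ v1 + (μ - v1) / (v2 - v1) * φ v2)
        atTop atTop) := by
  have hrw : ∀ v : ℝ, v1 < v → (v - μ) / (v - v1) * φ v1 + (μ - v1) / (v - v1) * φ v
      = φ v1 + (μ - v1) * ((φ v - φ v1) / (v - v1)) := by
    intro v hv
    have : v - v1 ≠ 0 := (sub_pos.2 hv).ne'
    field_simp
    ring
  have hmem : ∀ v2 ∈ Set.Ioi μ, v1 < v2 := fun v2 h => hv1.trans h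
  refine ⟨?_, ?_, ?_⟩
  · intro v2 h2
    have h12 := hmem v2 h2
    have hp : 0 < v2 - v1 := sub_pos.2 h12
    have hev : (fun v => (v - μ) / (v - v1) * φ v1 + (μ - v1) / (v - v1) * φ v)
        =ᶠ[nhds v2] (fun v => φ v1 + (μ - v1) * ((φ v - φ v1) / (v - v1))) := by
      filter_upwards [lt_mem_nhds h12] with v hv using hrw v hv
    rw [hev.deriv_eq]
    have hd := (hdiff v2 h2).hasDerivAt
    have hD := ((((hd.sub_const (φ v1)).div ((hasDerivAt_id v2).sub_const v1)
      hp.ne').const_mul (μ - v1)).const_add (φ v1)).deriv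
    have hs := hconv.slope_lt_of_hasDerivAt (Set.mem_univ v1) (Set.mem_univ v2) h12 hd
    rw [slope_def_field, div_lt_iff₀ hp] at hs
    refine lt_of_lt_of_eq ?_ hD.symm
    refine mul_pos (sub_pos.2 hv1) (div_pos ?_ (by simpa using pow_pos hp 2))
    simp only [id]
    linarith
  · intro a ha b hb hab
    simp only
    rw [hrw a (hmem a ha), hrw b (hmem b hb)]
    have := hconv.secant_strict_mono (Set.mem_univ v1) (Set.mem_univ a) (Set.mem_univ b)
      (hmem a ha).ne' (hmem b hb).ne' hab
    have := mul_lt_mul_of_pos_left this (sub_pos.2 hv1)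
    linarith
  · intro hT
    have hsub : Tendsto (fun v : ℝ => v - v1) atTop atTop :=
      tendsto_atTop_add_const_right _ (-v1) tendsto_id
    have hinv := hsub.inv_tendsto_atTop
    have h1 : Tendsto (fun v : ℝ => 1 + v1 * (v - v1)⁻¹) atTop (nhds (1 + v1 * 0)) :=
      (hinv.const_mul v1).const_add 1
    have h2 : Tendsto (fun v : ℝ => φ v1 - (μ - v1) * φ v1 * (v - v1)⁻¹) atTop
        (nhds (φ v1 - (μ - v1) * φ v1 * 0)) :=
      (hinv.const_mul _).const_sub _
    have h3 := (hT.atTop_mul_pos (by norm_num) h1).const_mul_atTop (sub_pos.2 hv1)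
    refine (h2.add_atTop h3).congr' ?_
    filter_upwards [eventually_gt_atTop v1, eventually_gt_atTop 0] with v hv hv0
    have : v - v1 ≠ 0 := (sub_pos.2 hv).ne'
    rw [hrw v hv]
    field_simp
    ring
end

section
/- Let μ ∈ ℝ, s > 0, and let φ satisfy the assumption on the dispersion function. Then for every v < μ there exists a unique v2(v) > μ such that, setting w2(v) = (μ − v)/(v2(v) − v) and w1(v) = 1 − w2(v), the two-point distribution with data (v, w1(v), v2(v), w2(v)) belongs to P(μ,s,φ). Moreover, the map v ↦ v2(v) is strictly increasing on (−∞, μ) and v2(v) → ∞ as v ↑ μ. -/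
open MeasureTheory Filter

/-- The two-point distribution with data `(v1, w1, v2, w2)`. -/
noncomputable def twoPoint (v1 w1 v2 w2 : ℝ) : Measure ℝ :=
  (ENNReal.ofReal w1) • Measure.dirac v1 + (ENNReal.ofReal w2) • Measure.dirac v2

/-- Membership in the ambiguity set `P(μ,s,φ)`. -/
def memAmb (μ s : ℝ) (φ : ℝ → ℝ) (P : Measure ℝ) : Prop :=
  IsProbabilityMeasure P ∧ Integrable (fun x : ℝ => x) P ∧ (∫ x, x ∂P) = μ ∧
  Integrable φ P ∧ (∫ x, φ x ∂P) = s

/-- The assumption on the dispersion function `φ`. -/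
structure DispersionOK (μ : ℝ) (φ : ℝ → ℝ) : Prop where
  strict_convex : StrictConvexOn ℝ Set.univ φ
  diff : ∀ x : ℝ, x ≠ μ → DifferentiableAt ℝ φ x
  growth : Tendsto (fun x : ℝ => |φ x / x|) (cocompact ℝ) atTop
  zero : φ μ = 0
  isMin : ∀ x : ℝ, φ μ ≤ φ x

/-- auxiliary function -/
noncomputable def auxK (μ s : ℝ) (φ : ℝ → ℝ) (v u : ℝ) : ℝ :=
  (u - μ) * φ v + (μ - v) * φ u - s * (u - v)

theorem memAmb_iff_auxK (μ s : ℝ) (φ : ℝ → ℝ) (v u : ℝ) (hv : v < μ) (hu : μ < u) :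
    memAmb μ s φ (twoPoint v (1 - (μ - v) / (u - v)) u ((μ - v) / (u - v))) ↔
      auxK μ s φ v u = 0 := by
  have hd : 0 < u - v := by linarith
  have h2 : 0 ≤ (μ - v) / (u - v) := div_nonneg (by linarith) hd.le
  have h1 : 0 ≤ 1 - (μ - v) / (u - v) := by
    rw [sub_nonneg, div_le_one hd]; linarith
  have hint : ∀ f : ℝ → ℝ, ∀ w x : ℝ, Integrable f (ENNReal.ofReal w • Measure.dirac x) := by
    intro f w x
    exact (integrable_dirac (by simp)).smul_measure ENNReal.ofReal_ne_top
  have hI : ∀ f : ℝ → ℝ, Integrable f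
      (twoPoint v (1 - (μ - v) / (u - v)) u ((μ - v) / (u - v))) := by
    intro f
    exact (hint f _ _).add_measure (hint f _ _)
  have hE : ∀ f : ℝ → ℝ, ∫ x, f x ∂(twoPoint v (1 - (μ - v) / (u - v)) u ((μ - v) / (u - v)))
      = (1 - (μ - v) / (u - v)) * f v + (μ - v) / (u - v) * f u := by
    intro f
    unfold twoPoint
    rw [integral_add_measure (hint f _ _) (hint f _ _), integral_smul_measure,
      integral_smul_measure, integral_dirac, integral_dirac, ENNReal.toReal_ofReal h1,
      ENNReal.toReal_ofReal h2]
    simp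
  have hP : IsProbabilityMeasure
      (twoPoint v (1 - (μ - v) / (u - v)) u ((μ - v) / (u - v))) := by
    constructor
    unfold twoPoint
    simp only [Measure.coe_add, Measure.coe_smul, Pi.add_apply, Pi.smul_apply, measure_univ,
      smul_eq_mul, mul_one]
    rw [← ENNReal.ofReal_add h1 h2]
    simp
  have hm : ∫ x, x ∂(twoPoint v (1 - (μ - v) / (u - v)) u ((μ - v) / (u - v))) = μ := by
    rw [hE (fun x => x)]
    field_simp
    ring
  have key : (∫ x, φ x ∂(twoPoint v (1 - (μ - v) / (u - v)) u ((μ - v) / (u - v)))) - s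
      = auxK μ s φ v u / (u - v) := by
    rw [hE φ]; unfold auxK
    field_simp
    ring
  constructor
  · rintro ⟨-, -, -, -, h⟩
    rw [h, sub_self] at key
    have := key.symm
    rw [div_eq_zero_iff] at this
    rcases this with h | h
    · exact h
    · exact absurd h hd.ne'
  · intro h
    rw [h, zero_div] at key
    exact ⟨hP, hI _, hm, hI _, by linarith⟩

theorem stmt2 (μ s : ℝ) (φ : ℝ → ℝ) (hs : 0 < s) (hφ : DispersionOK μ φ) :
    ∃ V : ℝ → ℝ,
      (∀ v < μ, μ < V v ∧
        memAmb μ s φ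
          (twoPoint v (1 - (μ - v) / (V v - v)) (V v) ((μ - v) / (V v - v))) ∧
        (∀ u, μ < u →
          memAmb μ s φ (twoPoint v (1 - (μ - v) / (u - v)) u ((μ - v) / (u - v))) →
          u = V v)) ∧
      StrictMonoOn V (Set.Iio μ) ∧
      Tendsto V (nhdsWithin μ (Set.Iio μ)) atTop := by
  have hz := hφ.zero
  have hcont : Continuous φ := by
    rw [← continuousOn_univ]
    exact hφ.strict_convex.convexOn.continuousOn isOpen_univ
  have hc : ∀ x y z : ℝ, x < y → y < z → φ y * (z - x) < φ x * (z - y) + φ z * (y - x) := by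
    intro x y z hxy hyz
    have h := hφ.strict_convex.slope_strict_mono_adjacent (Set.mem_univ x) (Set.mem_univ z) hxy hyz
    rw [div_lt_div_iff₀ (by linarith) (by linarith)] at h
    linarith
  -- once nonnegative, positive afterwards
  have hA : ∀ v u u' : ℝ, v < μ → μ < u → u < u' → 0 ≤ auxK μ s φ v u →
      0 < auxK μ s φ v u' := by
    intro v u u' hv hu huu h
    have h1 := mul_lt_mul_of_pos_left (hc μ u u' hu huu) (sub_pos.2 hv)
    have h2 : auxK μ s φ v u * (u' - μ) <
        auxK μ s φ v μ * (u' - u) + auxK μ s φ v u' * (u - μ) := by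
      unfold auxK; linarith
    have h3 : auxK μ s φ v μ * (u' - u) < 0 := by
      unfold auxK; rw [hz]
      have : 0 < s * (μ - v) * (u' - u) :=
        mul_pos (mul_pos hs (sub_pos.2 hv)) (sub_pos.2 huu)
      linarith
    have h4 : 0 ≤ auxK μ s φ v u * (u' - μ) := mul_nonneg h (by linarith)
    exact pos_of_mul_pos_left (b := u - μ) (by linarith) (by linarith)
  have hB : ∀ v v' u : ℝ, v < v' → v' < μ → μ < u → auxK μ s φ v u = 0 →
      auxK μ s φ v' u < 0 := by
    intro v v' u hvv hv hu h
    have h1 := mul_lt_mul_of_pos_left (hc v v' μ hvv hv) (sub_pos.2 hu)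
    have h2 : auxK μ s φ v' u * (μ - v) <
        auxK μ s φ v u * (μ - v') + auxK μ s φ μ u * (v' - v) := by
      unfold auxK; linarith
    have h3 : auxK μ s φ μ u * (v' - v) < 0 := by
      unfold auxK; rw [hz]
      have : 0 < s * (u - μ) * (v' - v) :=
        mul_pos (mul_pos hs (sub_pos.2 hu)) (sub_pos.2 hvv)
      linarith
    rw [h] at h2
    by_contra hcon
    have := mul_nonneg (not_lt.1 hcon) (by linarith : 0 ≤ μ - v)
    linarith
  have hex : ∀ v : ℝ, v < μ → ∃ u, μ < u ∧ auxK μ s φ v u = 0 := by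
    intro v hv
    have hp : 0 < μ - v := sub_pos.2 hv
    have hg : Tendsto (fun x : ℝ => |φ x / x|) atTop atTop :=
      hφ.growth.mono_left atTop_le_cocompact
    obtain ⟨u, hu1, hu2, hu3, hu4⟩ := ((hg.eventually_ge_atTop ((s + 1) / (μ - v))).and
      ((eventually_gt_atTop μ).and ((eventually_gt_atTop 0).and
        (eventually_gt_atTop (-(s * v)))))).exists
    have hφu : 0 ≤ φ u := hz ▸ hφ.isMin u
    have hφv : 0 ≤ φ v := hz ▸ hφ.isMin v
    rw [abs_of_nonneg (div_nonneg hφu hu3.le), div_le_div_iff₀ hp hu3] at hu1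
    have hpos : 0 < auxK μ s φ v u := by
      unfold auxK
      have := mul_nonneg (sub_nonneg.2 hu2.le) hφv
      nlinarith
    have hneg : auxK μ s φ v μ < 0 := by
      unfold auxK; rw [hz]
      have := mul_pos hs hp
      linarith
    have hcK : Continuous (auxK μ s φ v) := by
      unfold auxK; fun_prop
    obtain ⟨x, hx, hx0⟩ := intermediate_value_Icc hu2.le hcK.continuousOn
      (show (0:ℝ) ∈ Set.Icc _ _ from ⟨hneg.le, hpos.le⟩)
    refine ⟨x, lt_of_le_of_ne hx.1 ?_, hx0⟩
    rintro rfl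
    linarith
  choose! V hV1 hV2 using hex
  refine ⟨V, ?_, ?_, ?_⟩
  · intro v hv
    refine ⟨hV1 v hv, (memAmb_iff_auxK μ s φ v _ hv (hV1 v hv)).2 (hV2 v hv), ?_⟩
    intro u hu hm
    rw [memAmb_iff_auxK μ s φ v u hv hu] at hm
    rcases lt_trichotomy u (V v) with h | h | h
    · have := hA v u _ hv hu h hm.ge
      rw [hV2 v hv] at this
      exact absurd this (lt_irrefl _)
    · exact h
    · have := hA v _ u hv (hV1 v hv) h (hV2 v hv).ge
      linarith
  · intro v hv v' hv' hlt
    have hv : v < μ := hv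
    have hv' : v' < μ := hv'
    have h1 := hB v v' (V v) hlt hv' (hV1 v hv) (hV2 v hv)
    by_contra hcon
    rcases (not_lt.1 hcon).lt_or_eq with h | h
    · have := hA v' _ _ hv' (hV1 v' hv') h (hV2 v' hv').ge
      linarith
    · rw [← h, hV2 v' hv'] at h1
      exact lt_irrefl _ h1
  · rw [tendsto_atTop]
    intro M
    have hM : μ < max M (μ + 1) := lt_of_lt_of_le (by linarith) (le_max_right _ _)
    have hcK : Continuous (fun v => auxK μ s φ v (max M (μ + 1))) := by
      unfold auxK; fun_prop
    have hneg : auxK μ s φ μ (max M (μ + 1)) < 0 := by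
      unfold auxK; rw [hz]
      have := mul_pos hs (sub_pos.2 hM)
      linarith
    have hev := (hcK.tendsto μ).eventually_lt_const hneg
    filter_upwards [mem_nhdsWithin_of_mem_nhds hev, self_mem_nhdsWithin] with v hv1 hv2
    have hv2 : v < μ := hv2
    have hv1 : auxK μ s φ v (max M (μ + 1)) < 0 := hv1
    by_contra hcon
    have hlt : V v < max M (μ + 1) := lt_of_lt_of_le (not_le.1 hcon) (le_max_left _ _)
    have := hA v _ _ hv2 (hV1 v hv2) hlt (hV2 v hv2).ge
    linarith
end

section
/- Let μ ∈ ℝ and d > 0. For every v1 < μ − d/2, set w1(v1) = d/(2(μ − v1)), w2(v1) = 1 − d/(2(μ − v1)), and v2(v1) = μ + d/2 + d²/(4μ − 4v1 − 2d). Then the two-point distribution with data (v1, w1(v1), v2(v1), w2(v1)) belongs to the mean-MAD ambiguity set P(μ,d). Moreover, v2(v1) > μ + d/2, the map v1 ↦ v2(v1) is strictly increasing on (−∞, μ − d/2), and v2(v1) → ∞ as v1 ↑ μ − d/2. -/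
open MeasureTheory Filter

/-- Membership in the mean-MAD ambiguity set `P(μ,d)`. -/
def memMAD (μ d : ℝ) (P : Measure ℝ) : Prop :=
  IsProbabilityMeasure P ∧ Integrable (fun x : ℝ => x) P ∧ (∫ x, x ∂P) = μ ∧
  Integrable (fun x : ℝ => |x - μ|) P ∧ (∫ x, |x - μ| ∂P) = d

theorem twoPoint_int (v1 w1 v2 w2 : ℝ) (h1 : 0 ≤ w1) (h2 : 0 ≤ w2) (f : ℝ → ℝ) :
    Integrable f (twoPoint v1 w1 v2 w2) ∧
      ∫ x, f x ∂(twoPoint v1 w1 v2 w2) = w1 * f v1 + w2 * f v2 := by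
  have i1 : Integrable f ((ENNReal.ofReal w1) • Measure.dirac v1) :=
    (integrable_dirac (by simp)).smul_measure ENNReal.ofReal_ne_top
  have i2 : Integrable f ((ENNReal.ofReal w2) • Measure.dirac v2) :=
    (integrable_dirac (by simp)).smul_measure ENNReal.ofReal_ne_top
  refine ⟨i1.add_measure i2, ?_⟩
  unfold twoPoint
  rw [integral_add_measure i1 i2, integral_smul_measure, integral_smul_measure,
    integral_dirac, integral_dirac, ENNReal.toReal_ofReal h1, ENNReal.toReal_ofReal h2]
  simp

/-- Explicit two-point distributions in the mean-MAD ambiguity set. -/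
theorem stmt4 (μ d : ℝ) (hd : 0 < d) :
    (∀ v1 < μ - d / 2,
      memMAD μ d
        (twoPoint v1 (d / (2 * (μ - v1)))
          (μ + d / 2 + d ^ 2 / (4 * μ - 4 * v1 - 2 * d))
          (1 - d / (2 * (μ - v1)))) ∧
      μ + d / 2 < μ + d / 2 + d ^ 2 / (4 * μ - 4 * v1 - 2 * d)) ∧
    StrictMonoOn (fun v1 => μ + d / 2 + d ^ 2 / (4 * μ - 4 * v1 - 2 * d))
      (Set.Iio (μ - d / 2)) ∧
    Tendsto (fun v1 => μ + d / 2 + d ^ 2 / (4 * μ - 4 * v1 - 2 * d))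
      (nhdsWithin (μ - d / 2) (Set.Iio (μ - d / 2))) atTop := by
  have pos : ∀ v1 < μ - d / 2, 0 < 4 * μ - 4 * v1 - 2 * d := by
    intro v1 h; linarith
  refine ⟨fun v1 hv => ?_, ?_, ?_⟩
  · have hp := pos v1 hv
    have ha : 0 < μ - v1 := by linarith
    have hq : 0 < d ^ 2 / (4 * μ - 4 * v1 - 2 * d) := by positivity
    refine ⟨?_, by linarith⟩
    have h1 : 0 ≤ d / (2 * (μ - v1)) := by positivity
    have h2 : 0 ≤ 1 - d / (2 * (μ - v1)) := by
      rw [sub_nonneg, div_le_one (by positivity)]; linarith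
    have key : (1 - d / (2 * (μ - v1))) * (d / 2 + d ^ 2 / (4 * μ - 4 * v1 - 2 * d)) = d / 2 := by
      have e1 := ha.ne'
      have e2 := hp.ne'
      obtain ⟨a, rfl⟩ : ∃ a, v1 = μ - a := ⟨μ - v1, by ring⟩
      have e3 : a ≠ 0 := by simpa using e1
      have e4 : 4 * μ - 4 * (μ - a) - 2 * d = 2 * (2 * a - d) := by ring
      have e5 : 2 * a - d ≠ 0 := by intro h; apply e2; rw [e4, h]; ring
      rw [e4, sub_sub_cancel]
      field_simp
      ring
    have key1 : d / (2 * (μ - v1)) * (μ - v1) = d / 2 := by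
      field_simp
    obtain ⟨i1, j1⟩ := twoPoint_int v1 _ (μ + d / 2 + d ^ 2 / (4 * μ - 4 * v1 - 2 * d)) _ h1 h2
      (fun x => x)
    obtain ⟨i2, j2⟩ := twoPoint_int v1 _ (μ + d / 2 + d ^ 2 / (4 * μ - 4 * v1 - 2 * d)) _ h1 h2
      (fun x => |x - μ|)
    refine ⟨⟨?_⟩, i1, ?_, i2, ?_⟩
    · simp only [twoPoint, Measure.add_apply, Measure.smul_apply, measure_univ, smul_eq_mul,
        mul_one]
      rw [← ENNReal.ofReal_add h1 h2]
      simp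
    · rw [j1]
      linear_combination key - key1
    · rw [j2]
      rw [abs_of_neg (by linarith), abs_of_pos (by linarith)]
      linear_combination key + key1
  · intro x hx y hy hxy
    have hpx := pos x hx
    have hpy := pos y hy
    simp only
    gcongr
  · apply tendsto_atTop_add_const_left
    simp only [div_eq_mul_inv (d ^ 2)]
    apply Tendsto.const_mul_atTop (by positivity)
    apply tendsto_inv_nhdsGT_zero.comp
    rw [tendsto_nhdsWithin_iff]
    constructor
    · apply Tendsto.mono_left _ nhdsWithin_le_nhds
      have : Continuous (fun v1 : ℝ => 4 * μ - 4 * v1 - 2 * d) := by fun_prop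
      convert this.tendsto (μ - d / 2) using 2
      ring
    · filter_upwards [self_mem_nhdsWithin] with v hv using pos v hv
end

section
/- Let t ∈ ℝ and let P be a Borel probability measure on ℝ with integrable identity map X, such that P(X < t) > 0 and P(X ≥ t) > 0. Define w1 = P(X < t), v1 = E_P(X | X < t), w2 = P(X ≥ t), v2 = E_P(X | X ≥ t), and let P2 = w1·δ_{v1} + w2·δ_{v2}. Then: (i) P2 has mean E_{P2}[X] = E_P[X]; (ii) for every ψ_u : ℝ → ℝ that is concave on (−∞, t) and concave on [t, ∞) with ψ_u∘X P-integrable, E_{P2}[ψ_u(X)] ≥ E_P[ψ_u(X)]; (iii) for every ψ_ℓ : ℝ → ℝ that is convex on (−∞, t) and convex on [t, ∞) with ψ_ℓ∘X P-integrable, E_{P2}[ψ_ℓ(X)] ≤ E_P[ψ_ℓ(X)]; and (iv) for every convex φ : ℝ → ℝ with φ∘X P-integrable, E_{P2}[φ(X)] ≤ E_P[φ(X)]. -/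
open MeasureTheory

lemma aux_support {S : Set ℝ} {f : ℝ → ℝ} {v : ℝ} (hf : ConvexOn ℝ S f) (hv : v ∈ interior S) :
    ∃ c : ℝ, ∀ y ∈ S, f v + c * (y - v) ≤ f y := by
  refine ⟨derivWithin f (Set.Ioi v) v, fun y hy => ?_⟩
  rcases lt_trichotomy v y with h | h | h
  · have := hf.rightDeriv_le_slope_of_mem_interior hv hy h
    rw [slope_def_field, le_div_iff₀ (by linarith)] at this
    linarith
  · simp [h]
  · have := (hf.slope_le_leftDeriv_of_mem_interior hy hv h).trans
      (hf.leftDeriv_le_rightDeriv_of_mem_interior hv)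
    rw [slope_def_field, div_le_iff₀ (by linarith)] at this
    linarith

lemma aux_int {S : Set ℝ} {P : Measure ℝ} [IsProbabilityMeasure P]
    (hX : Integrable (fun x : ℝ => x) P) (a b : ℝ) :
    ∫ x in S, (a + b * x) ∂P = a * (P S).toReal + b * ∫ x in S, x ∂P := by
  rw [integral_add (integrable_const _) (hX.integrableOn.const_mul b), integral_const_mul]
  simp [Measure.real, mul_comm]

lemma aux_jensen {S : Set ℝ} {P : Measure ℝ} [IsProbabilityMeasure P]
    (hX : Integrable (fun x : ℝ => x) P) {f : ℝ → ℝ} (hf : Integrable f P) {v : ℝ}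
    (hv : (P S).toReal * v = ∫ x in S, x ∂P)
    (h : ∃ c : ℝ, ∀ᵐ y ∂(P.restrict S), f v + c * (y - v) ≤ f y) :
    (P S).toReal * f v ≤ ∫ x in S, f x ∂P := by
  obtain ⟨c, hc⟩ := h
  have h1 : ∫ x in S, ((f v - c * v) + c * x) ∂P ≤ ∫ x in S, f x ∂P := by
    refine integral_mono_ae ((integrable_const _).add (hX.integrableOn.const_mul c))
      hf.integrableOn ?_
    filter_upwards [hc] with y hy
    linarith
  rw [aux_int hX, ← hv] at h1
  linarith

lemma aux_Iio {t : ℝ} {P : Measure ℝ} [IsProbabilityMeasure P]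
    (hX : Integrable (fun x : ℝ => x) P) {f : ℝ → ℝ} (hf : Integrable f P) {v : ℝ}
    (h0 : 0 < (P (Set.Iio t)).toReal)
    (hv : (P (Set.Iio t)).toReal * v = ∫ x in Set.Iio t, x ∂P)
    (h : ConvexOn ℝ (Set.Iio t) f) :
    (P (Set.Iio t)).toReal * f v ≤ ∫ x in Set.Iio t, f x ∂P := by
  apply aux_jensen hX hf hv
  have hm : ∀ᵐ y ∂(P.restrict (Set.Iio t)), y < t := ae_restrict_mem measurableSet_Iio
  have hvt : v < t := by
    by_contra hn
    push Not at hn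
    have hi : Integrable (fun x : ℝ => t + (-1) * x) (P.restrict (Set.Iio t)) :=
      (integrable_const _).add (hX.integrableOn.const_mul _)
    have hnn : 0 ≤ᵐ[P.restrict (Set.Iio t)] (fun x : ℝ => t + (-1) * x) := by
      filter_upwards [hm] with y hy
      simp only [Pi.zero_apply]; linarith
    have he : ∫ x in Set.Iio t, (t + (-1) * x) ∂P = 0 := by
      apply le_antisymm _ (integral_nonneg_of_ae hnn)
      rw [aux_int hX, ← hv]
      nlinarith
    have hz := (integral_eq_zero_iff_of_nonneg_ae hnn hi).1 he
    have hF : ∀ᵐ y ∂(P.restrict (Set.Iio t)), False := by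
      filter_upwards [hz, hm] with y h1 h2
      simp only [Pi.zero_apply] at h1; linarith
    rw [Filter.eventually_false_iff_eq_bot, ae_eq_bot, Measure.restrict_eq_zero] at hF
    simp [hF] at h0
  obtain ⟨c, hc⟩ := aux_support h (v := v) (by rwa [interior_Iio])
  exact ⟨c, by filter_upwards [hm] with y hy using hc y hy⟩

lemma aux_Ici {t : ℝ} {P : Measure ℝ} [IsProbabilityMeasure P]
    (hX : Integrable (fun x : ℝ => x) P) {f : ℝ → ℝ} (hf : Integrable f P) {v : ℝ}
    (h0 : 0 < (P (Set.Ici t)).toReal)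
    (hv : (P (Set.Ici t)).toReal * v = ∫ x in Set.Ici t, x ∂P)
    (h : ConvexOn ℝ (Set.Ici t) f) :
    (P (Set.Ici t)).toReal * f v ≤ ∫ x in Set.Ici t, f x ∂P := by
  apply aux_jensen hX hf hv
  have hm : ∀ᵐ y ∂(P.restrict (Set.Ici t)), t ≤ y := ae_restrict_mem measurableSet_Ici
  rcases lt_or_ge t v with hvt | hn
  · obtain ⟨c, hc⟩ := aux_support h (v := v) (by rwa [interior_Ici])
    exact ⟨c, by filter_upwards [hm] with y hy using hc y hy⟩
  · have hi : Integrable (fun x : ℝ => -t + 1 * x) (P.restrict (Set.Ici t)) :=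
      (integrable_const _).add (hX.integrableOn.const_mul _)
    have hnn : 0 ≤ᵐ[P.restrict (Set.Ici t)] (fun x : ℝ => -t + 1 * x) := by
      filter_upwards [hm] with y hy
      simp only [Pi.zero_apply]; linarith
    have hge := integral_nonneg_of_ae hnn
    have he : ∫ x in Set.Ici t, (-t + 1 * x) ∂P = 0 := by
      apply le_antisymm _ hge
      rw [aux_int hX, ← hv]
      nlinarith
    have hz := (integral_eq_zero_iff_of_nonneg_ae hnn hi).1 he
    rw [aux_int hX, ← hv] at he
    have hvt : v = t := by
      have : (P (Set.Ici t)).toReal * (v - t) = 0 := by linarith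
      rcases mul_eq_zero.1 this with h | h <;> linarith
    refine ⟨0, ?_⟩
    filter_upwards [hz] with y hy
    simp only [Pi.zero_apply] at hy
    have : y = v := by linarith
    simp [this]

lemma aux_two (v1 w1 v2 w2 : ℝ) (h1 : 0 ≤ w1) (h2 : 0 ≤ w2) (f : ℝ → ℝ) :
    ∫ x, f x ∂(twoPoint v1 w1 v2 w2) = w1 * f v1 + w2 * f v2 := by
  unfold twoPoint
  have hd (v : ℝ) : Integrable f (Measure.dirac v) := integrable_dirac (by simp)
  rw [integral_add_measure ((hd v1).smul_measure (by simp)) ((hd v2).smul_measure (by simp))]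
  simp [integral_smul_measure, h1, h2]

/-- The conditional two-point reduction `P ↦ P2` preserves the mean,
does not decrease the expectation of piecewise concave functions, does not increase
the expectation of piecewise convex functions, and does not increase the expectation
of convex functions. -/
theorem stmt6 (t : ℝ) (P : Measure ℝ) [IsProbabilityMeasure P]
    (hX : Integrable (fun x : ℝ => x) P)
    (h1 : 0 < (P (Set.Iio t)).toReal) (h2 : 0 < (P (Set.Ici t)).toReal)
    (w1 v1 w2 v2 : ℝ)
    (hw1 : w1 = (P (Set.Iio t)).toReal)
    (hv1 : v1 = (∫ x in Set.Iio t, x ∂P) / (P (Set.Iio t)).toReal)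
    (hw2 : w2 = (P (Set.Ici t)).toReal)
    (hv2 : v2 = (∫ x in Set.Ici t, x ∂P) / (P (Set.Ici t)).toReal) :
    (∫ x, x ∂(twoPoint v1 w1 v2 w2)) = (∫ x, x ∂P) ∧
    (∀ ψu : ℝ → ℝ, ConcaveOn ℝ (Set.Iio t) ψu → ConcaveOn ℝ (Set.Ici t) ψu →
      Integrable ψu P → (∫ x, ψu x ∂P) ≤ ∫ x, ψu x ∂(twoPoint v1 w1 v2 w2)) ∧
    (∀ ψl : ℝ → ℝ, ConvexOn ℝ (Set.Iio t) ψl → ConvexOn ℝ (Set.Ici t) ψl →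
      Integrable ψl P → (∫ x, ψl x ∂(twoPoint v1 w1 v2 w2)) ≤ ∫ x, ψl x ∂P) ∧
    (∀ φ : ℝ → ℝ, ConvexOn ℝ Set.univ φ → Integrable φ P →
      (∫ x, φ x ∂(twoPoint v1 w1 v2 w2)) ≤ ∫ x, φ x ∂P) := by
  have e1 : (P (Set.Iio t)).toReal * v1 = ∫ x in Set.Iio t, x ∂P := by
    rw [hv1]; field_simp
  have e2 : (P (Set.Ici t)).toReal * v2 = ∫ x in Set.Ici t, x ∂P := by
    rw [hv2]; field_simp
  have hT := aux_two v1 w1 v2 w2 (by rw [hw1]; exact h1.le) (by rw [hw2]; exact h2.le)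
  have split : ∀ f : ℝ → ℝ, Integrable f P →
      ∫ x in Set.Iio t, f x ∂P + ∫ x in Set.Ici t, f x ∂P = ∫ x, f x ∂P := by
    intro f hf
    have := integral_add_compl (measurableSet_Iio (a := t)) hf
    rwa [Set.compl_Iio] at this
  have key : ∀ ψl : ℝ → ℝ, ConvexOn ℝ (Set.Iio t) ψl → ConvexOn ℝ (Set.Ici t) ψl →
      Integrable ψl P → (∫ x, ψl x ∂(twoPoint v1 w1 v2 w2)) ≤ ∫ x, ψl x ∂P := by
    intro f c1 c2 hf
    rw [hT, ← split f hf, hw1, hw2]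
    exact add_le_add (aux_Iio hX hf h1 e1 c1) (aux_Ici hX hf h2 e2 c2)
  refine ⟨?_, ?_, key, ?_⟩
  · rw [hT (fun x => x), ← split _ hX, hw1, hw2, e1, e2]
  · intro f c1 c2 hf
    have := key (-f) c1.neg c2.neg hf.neg
    simp only [Pi.neg_apply, integral_neg] at this
    linarith
  · intro f c hf
    exact key f (c.subset (Set.subset_univ _) (convex_Iio t))
      (c.subset (Set.subset_univ _) (convex_Ici t)) hf
end

section
/- Let μ ∈ ℝ, s > 0, let φ satisfy the assumption on the dispersion function, let t < μ, and let ψ : ℝ → ℝ be concave and increasing with ψ∘X P-integrable for every P ∈ P(μ,s,φ). Let v2* be the unique v2 > μ satisfying ((v2 − μ)/(v2 − t))·φ(t) + ((μ − t)/(v2 − t))·φ(v2) = s. Then sup over P ∈ P(μ,s,φ) of E_P(ψ(X) | X ≥ t) equals ψ(v2*). (Note that every P ∈ P(μ,s,φ) satisfies P(X ≥ t) > 0 since t < μ, so the conditional expectation is well defined.) -/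
open MeasureTheory Filter

lemma aux_subgrad {f : ℝ → ℝ} (hf : ConvexOn ℝ Set.univ f) (x : ℝ) :
    ∃ c, ∀ y, f x + c * (y - x) ≤ f y := by
  have hx : x ∈ interior (Set.univ : Set ℝ) := by simp
  refine ⟨derivWithin f (Set.Ioi x) x, fun y => ?_⟩
  rcases lt_trichotomy x y with h | h | h
  · have := hf.rightDeriv_le_slope_of_mem_interior hx (Set.mem_univ y) h
    rw [slope_def_field, le_div_iff₀ (by linarith)] at this
    linarith
  · subst h; simp
  · have h1 := hf.slope_le_leftDeriv_of_mem_interior (Set.mem_univ y) hx h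
    have h2 := hf.leftDeriv_le_rightDeriv_of_mem_interior hx
    have := h1.trans h2
    rw [slope_def_field, div_le_iff₀ (by linarith)] at this
    linarith

/-- Convexity in three-point form. -/
lemma aux_three {f : ℝ → ℝ} (hf : StrictConvexOn ℝ Set.univ f) {x y z : ℝ}
    (hxy : x < y) (hyz : y < z) : (z - x) * f y < (z - y) * f x + (y - x) * f z := by
  have h := hf.slope_strict_mono_adjacent (Set.mem_univ x) (Set.mem_univ z) hxy hyz
  rw [div_lt_div_iff₀ (by linarith) (by linarith)] at h
  linarith

/-- The dual certificate. -/
lemma aux_cert {φ : ℝ → ℝ} (hf : StrictConvexOn ℝ Set.univ φ) {t v : ℝ} (htv : t < v) :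
    ∃ m k : ℝ, 0 < k ∧ m * (v - t) = φ v - φ t ∧
      ∀ x, (Set.Ici t).indicator (fun x => k * (x - v)) x ≤ φ x - φ v - m * (x - v) := by
  obtain ⟨c, hc⟩ := aux_subgrad hf.convexOn v
  have hvt : 0 < v - t := by linarith
  refine ⟨(φ v - φ t) / (v - t), c - (φ v - φ t) / (v - t), ?_, by field_simp, ?_⟩
  · rw [sub_pos, div_lt_iff₀ hvt]
    have h1 := hc ((t + v) / 2)
    have h2 := aux_three hf (show t < (t + v) / 2 by linarith) (show (t + v) / 2 < v by linarith)
    nlinarith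
  · intro x
    have hm : (φ v - φ t) / (v - t) * (v - t) = φ v - φ t := by field_simp
    set m := (φ v - φ t) / (v - t)
    by_cases hx : x ∈ Set.Ici t
    · rw [Set.indicator_of_mem hx]
      linarith [hc x]
    · rw [Set.indicator_of_notMem hx]
      have hx : x < t := by simpa using hx
      have h2 := aux_three hf hx htv
      have h3 : φ t = φ v - m * (v - t) := by linarith
      rw [h3] at h2
      have : 0 < (v - t) * (φ x - φ v - m * (x - v)) := by linarith
      exact (pos_of_mul_pos_right this hvt.le).le

lemma aux_upper {μ s t : ℝ} {φ ψ : ℝ → ℝ} (hφ : DispersionOK μ φ) (ht : t < μ)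
    (hψ_conc : ConcaveOn ℝ Set.univ ψ) (hψ_mono : StrictMono ψ)
    {v : ℝ} (hv : μ < v)
    (heq : (v - μ) * φ t + (μ - t) * φ v = s * (v - t))
    {P : Measure ℝ} (hP : memAmb μ s φ P) (hi : Integrable ψ P) :
    (∫ x in Set.Ici t, ψ x ∂P) / (P (Set.Ici t)).toReal ≤ ψ v := by
  obtain ⟨hp, hX, hXe, hF, hFe⟩ := hP
  have hpos : 0 < (P (Set.Ici t)).toReal := by
    rw [ENNReal.toReal_pos_iff]
    refine ⟨pos_iff_ne_zero.2 fun h0 => ?_, measure_lt_top _ _⟩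
    have hae : ∀ᵐ x ∂P, x ≤ t := by
      have : ∀ᵐ x ∂P, x ∉ Set.Ici t := measure_eq_zero_iff_ae_notMem.1 h0
      filter_upwards [this] with x hx
      simp at hx; exact hx.le
    have := integral_mono_ae hX (integrable_const t) hae
    simp at this
    linarith
  rw [div_le_iff₀ hpos]
  obtain ⟨m, k, hk, hm, hcert⟩ := aux_cert hφ.strict_convex (show t < v by linarith)
  have hlin : Integrable (fun x : ℝ => k * (x - v)) P := (hX.sub (integrable_const v)).const_mul k
  have hlin0 : Integrable (fun x : ℝ => x - v) P := hX.sub (integrable_const v)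
  have I1 : ∫ x in Set.Ici t, k * (x - v) ∂P ≤ 0 := by
    rw [← integral_indicator measurableSet_Ici]
    refine (integral_mono (hlin.indicator measurableSet_Ici)
      ((hF.sub (integrable_const (φ v))).sub (hlin0.const_mul m)) hcert).trans ?_
    have e : ∫ x, (φ x - φ v - m * (x - v)) ∂P = s - φ v - m * (μ - v) := by
      have hF1 : Integrable (fun x => φ x - φ v) P := hF.sub (integrable_const (φ v))
      rw [integral_sub hF1 (hlin0.const_mul m),
        integral_sub hF (integrable_const _), integral_const_mul,
        integral_sub hX (integrable_const _), hXe, hFe]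
      simp
    refine (le_of_eq e).trans ?_
    have : (s - φ v - m * (μ - v)) * (v - t) = 0 := by linear_combination (-1) * heq - (μ - v) * hm
    rcases mul_eq_zero.1 this with h | h
    · exact h.le
    · linarith
  rw [integral_const_mul] at I1
  have I2 : ∫ x in Set.Ici t, (x - v) ∂P ≤ 0 := by
    by_contra h
    push Not at h
    have := mul_pos hk h
    linarith
  obtain ⟨c, hc⟩ := aux_subgrad hψ_conc.neg v
  have hc0 : 0 ≤ -c := by
    have := hc (v + 1)
    have h2 := hψ_mono (show v < v + 1 by linarith)
    simp at this
    linarith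
  have I3 : ∫ x in Set.Ici t, ψ x ∂P ≤ ∫ x in Set.Ici t, (ψ v + (-c) * (x - v)) ∂P := by
    refine integral_mono hi.integrableOn
      ((integrable_const (ψ v)).add (hlin0.const_mul (-c))).integrableOn fun x => ?_
    have := hc x
    simp at this
    simp only
    linarith
  rw [integral_add (integrable_const _) (hlin0.const_mul (-c)).integrableOn,
    integral_const_mul] at I3
  simp [Measure.real] at I3
  nlinarith [mul_nonneg hc0 (neg_nonneg.2 I2)]

lemma aux_exists {μ s t : ℝ} {φ : ℝ → ℝ} (hφ : DispersionOK μ φ) (hs : 0 < s) (ht : t < μ)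
    {v v2 : ℝ} (hv : μ < v) (hv2 : v < v2)
    (heq : (v2 - μ) * φ t + (μ - t) * φ v2 = s * (v2 - t)) :
    ∃ l < t, (v - μ) * φ l + (μ - l) * φ v = s * (v - l) := by
  have hcont : Continuous φ :=
    continuousOn_univ.1 (hφ.strict_convex.convexOn.continuousOn isOpen_univ)
  have h0 : ∀ x, 0 ≤ φ x := fun x => hφ.zero ▸ hφ.isMin x
  have hneg : (v - μ) * φ t + (μ - t) * φ v < s * (v - t) := by
    have h1 := aux_three hφ.strict_convex hv hv2
    rw [hφ.zero] at h1
    have h2 : (v2 - μ) * ((v - μ) * φ t + (μ - t) * φ v) < (v2 - μ) * (s * (v - t)) := by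
      have h3 := mul_lt_mul_of_pos_left h1 (show 0 < μ - t by linarith)
      have h4 : 0 ≤ s * ((μ - t) * (v2 - v)) :=
        mul_nonneg hs.le (mul_nonneg (by linarith) (by linarith))
      have h5 : (v - μ) * ((v2 - μ) * φ t + (μ - t) * φ v2) = (v - μ) * (s * (v2 - t)) := by
        rw [heq]
      linarith
    exact lt_of_mul_lt_mul_left h2 (by linarith)
  obtain ⟨L, hLt, hL⟩ : ∃ L < t, s * (v - L) ≤ (v - μ) * φ L + (μ - L) * φ v := by
    have hg : Tendsto (fun x : ℝ => |φ x / x|) atBot atTop :=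
      hφ.growth.mono_left (by rw [cocompact_eq_atBot_atTop]; exact le_sup_left)
    obtain ⟨L, hg1, hL1, hL2⟩ := ((hg.eventually_ge_atTop (2 * s / (v - μ))).and
      ((eventually_lt_atBot t).and (eventually_lt_atBot (-|v| - 1)))).exists
    refine ⟨L, hL1, ?_⟩
    have hL0 : 0 < -L := by linarith [abs_nonneg v]
    have hLv : v ≤ -L := by linarith [le_abs_self v]
    rw [abs_div, abs_of_nonneg (h0 L), abs_of_neg (by linarith : L < 0),
      div_le_div_iff₀ (by linarith) hL0] at hg1
    have := mul_nonneg (show 0 ≤ μ - L by linarith) (h0 v)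
    nlinarith [mul_nonneg hs.le (show 0 ≤ -L - v by linarith)]
  have hG : Continuous (fun l : ℝ => (v - μ) * φ l + (μ - l) * φ v - s * (v - l)) := by fun_prop
  obtain ⟨l, hl, hle⟩ := intermediate_value_Icc' hLt.le hG.continuousOn
    (show (0 : ℝ) ∈ Set.Icc _ _ from ⟨by linarith, by linarith⟩)
  have hle : (v - μ) * φ l + (μ - l) * φ v - s * (v - l) = 0 := hle
  refine ⟨l, lt_of_le_of_ne hl.2 ?_, by linarith⟩
  rintro rfl
  linarith

lemma aux_measure {μ s t : ℝ} {φ ψ : ℝ → ℝ} {l v : ℝ} (hl : l < t) (ht : t < μ) (hv : μ < v)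
    (heq : (v - μ) * φ l + (μ - l) * φ v = s * (v - l)) :
    ∃ P : Measure ℝ, memAmb μ s φ P ∧
      ψ v = (∫ x in Set.Ici t, ψ x ∂P) / (P (Set.Ici t)).toReal := by
  have hd : 0 < v - l := by linarith
  obtain ⟨a, ha⟩ : ∃ a, a = (v - μ) / (v - l) := ⟨_, rfl⟩
  obtain ⟨b, hb⟩ : ∃ b, b = (μ - l) / (v - l) := ⟨_, rfl⟩
  have ha0 : 0 < a := ha ▸ div_pos (by linarith) hd
  have hb0 : 0 < b := hb ▸ div_pos (by linarith) hd
  have hab : a + b = 1 := by rw [ha, hb]; field_simp; ring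
  have hm : a * l + b * v = μ := by rw [ha, hb]; field_simp; ring
  have hsφ : a * φ l + b * φ v = s := by
    rw [ha, hb]; field_simp; linarith
  have hint : ∀ (f : ℝ → ℝ) (c x : ℝ), Integrable f (ENNReal.ofReal c • Measure.dirac x) :=
    fun f c x => (integrable_dirac (by simp)).smul_measure ENNReal.ofReal_ne_top
  have hI : ∀ f : ℝ → ℝ, ∫ x, f x ∂(ENNReal.ofReal a • Measure.dirac l +
      ENNReal.ofReal b • Measure.dirac v) = a * f l + b * f v := by
    intro f
    rw [integral_add_measure (hint f a l) (hint f b v), integral_smul_measure,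
      integral_smul_measure, integral_dirac, integral_dirac, ENNReal.toReal_ofReal ha0.le,
      ENNReal.toReal_ofReal hb0.le]
    simp
  have hl' : l ∉ Set.Ici t := by simpa using hl
  have hv' : v ∈ Set.Ici t := by simp; linarith
  refine ⟨ENNReal.ofReal a • Measure.dirac l + ENNReal.ofReal b • Measure.dirac v,
    ⟨⟨?_⟩, (hint _ a l).add_measure (hint _ b v), ?_, (hint _ a l).add_measure (hint _ b v), ?_⟩, ?_⟩
  · simp [← ENNReal.ofReal_add ha0.le hb0.le, hab]
  · rw [hI, hm]
  · rw [hI, hsφ]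
  · rw [← integral_indicator measurableSet_Ici, hI, Set.indicator_of_notMem hl',
      Set.indicator_of_mem hv']
    simp only [Measure.add_apply, Measure.smul_apply, Measure.dirac_apply, Set.indicator_of_notMem hl',
      Set.indicator_of_mem hv']
    simp [ENNReal.toReal_ofReal hb0.le]
    field_simp

/-- Tight upper bound for the conditional expectation
`E_P(ψ(X) | X ≥ t)` over the ambiguity set `P(μ,s,φ)`, for `t < μ`. -/
theorem stmt7 (μ s t : ℝ) (φ ψ : ℝ → ℝ) (hs : 0 < s) (hφ : DispersionOK μ φ)
    (ht : t < μ)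
    (hψ_conc : ConcaveOn ℝ Set.univ ψ) (hψ_mono : StrictMono ψ)
    (hψ_int : ∀ P : Measure ℝ, memAmb μ s φ P → Integrable ψ P)
    (v2s : ℝ) (hv2s : μ < v2s)
    (heq : (v2s - μ) / (v2s - t) * φ t + (μ - t) / (v2s - t) * φ v2s = s)
    (huniq : ∀ u, μ < u →
      (u - μ) / (u - t) * φ t + (μ - t) / (u - t) * φ u = s → u = v2s) :
    sSup {y : ℝ | ∃ P : Measure ℝ, memAmb μ s φ P ∧
        y = (∫ x in Set.Ici t, ψ x ∂P) / (P (Set.Ici t)).toReal} = ψ v2s := by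
  have heq' : (v2s - μ) * φ t + (μ - t) * φ v2s = s * (v2s - t) := by
    have : 0 < v2s - t := by linarith
    field_simp at heq
    linarith
  have hmem : ∀ v, μ < v → v < v2s → ψ v ∈ {y : ℝ | ∃ P : Measure ℝ, memAmb μ s φ P ∧
        y = (∫ x in Set.Ici t, ψ x ∂P) / (P (Set.Ici t)).toReal} := by
    intro v h1 h2
    obtain ⟨l, hl, he⟩ := aux_exists hφ hs ht h1 h2 heq'
    exact aux_measure hl ht h1 he
  refine csSup_eq_of_forall_le_of_forall_lt_exists_gt
    ⟨_, hmem ((μ + v2s) / 2) (by linarith) (by linarith)⟩ ?_ ?_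
  · rintro y ⟨P, hP, rfl⟩
    exact aux_upper hφ ht hψ_conc hψ_mono hv2s heq' hP (hψ_int P hP)
  · intro w hw
    have hcont : Continuous ψ := continuousOn_univ.1 (hψ_conc.continuousOn isOpen_univ)
    have h1 : ∀ᶠ v in nhdsWithin v2s (Set.Iio v2s), w < ψ v :=
      (hcont.tendsto v2s).mono_left nhdsWithin_le_nhds |>.eventually (lt_mem_nhds hw)
    have h2 : ∀ᶠ v in nhdsWithin v2s (Set.Iio v2s), v ∈ Set.Ioo μ v2s := Ioo_mem_nhdsLT hv2s
    obtain ⟨v, hv1, hv2⟩ := (h1.and h2).exists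
    exact ⟨ψ v, hmem v hv2.1 hv2.2, hv1⟩
end

section
/- Let μ ∈ ℝ, p > 1, s > 0 and t < μ. Let a > 0 be the unique positive solution of (μ − t)·a^p + ((μ − t)^p − s^p)·a − (μ − t)·s^p = 0. Then sup over P ∈ P(μ,s^p) of E_P(X | X ≥ t) equals μ + a. -/
open MeasureTheory

/-- Membership in the ambiguity set `P(μ,s^p)` defined by the `p`th power deviation. -/
def memAmbPow (μ p s : ℝ) (P : Measure ℝ) : Prop :=
  IsProbabilityMeasure P ∧ Integrable (fun x : ℝ => x) P ∧ (∫ x, x ∂P) = μ ∧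
  Integrable (fun x : ℝ => |x - μ| ^ p) P ∧ (∫ x, |x - μ| ^ p ∂P) = s ^ p

lemma aux_tangent (p a y : ℝ) (hp : 1 < p) (ha : 0 < a) :
    a ^ p + p * (a ^ (p - 1)) * (|y| - a) ≤ |y| ^ p := by
  have h := one_add_mul_self_le_rpow_one_add (s := |y| / a - 1)
    (by have : 0 ≤ |y| / a := by positivity
        linarith) hp.le
  have e : 1 + (|y| / a - 1) = |y| / a := by ring
  rw [e, Real.div_rpow (abs_nonneg y) ha.le, le_div_iff₀ (by positivity)] at h
  have e2 : a ^ p = a * a ^ (p - 1) := by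
    rw [Real.rpow_sub_one ha.ne']; field_simp
  have e3 : (1 + p * (|y| / a - 1)) * a ^ p = a ^ p + p * (a ^ (p - 1)) * (|y| - a) := by
    rw [e2]; field_simp
  linarith

lemma aux_upper_s8 (μ p s t : ℝ) (hp : 1 < p) (hs : 0 < s) (ht : t < μ)
    (a : ℝ) (ha : 0 < a)
    (heq : (μ - t) * a ^ p + ((μ - t) ^ p - s ^ p) * a - (μ - t) * s ^ p = 0)
    (P : Measure ℝ) (hP : memAmbPow μ p s P) :
    (∫ x in Set.Ici t, x ∂P) / (P (Set.Ici t)).toReal ≤ μ + a := by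
  obtain ⟨hprob, hi, hm, hip, hsp⟩ := hP
  obtain ⟨d, hd⟩ : ∃ d, d = μ - t := ⟨_, rfl⟩
  rw [← hd] at heq
  have hd0 : 0 < d := by linarith
  have hsp0 : 0 < s ^ p := by positivity
  have hap0 : 0 < a ^ p := by positivity
  have hdp0 : 0 < d ^ p := by positivity
  have had : a ^ p = a * a ^ (p - 1) := by
    rw [Real.rpow_sub_one ha.ne']; field_simp
  have hdd : d ^ p = d * d ^ (p - 1) := by
    rw [Real.rpow_sub_one hd0.ne']; field_simp
  have ha1 : 0 < a ^ (p - 1) := by positivity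
  have hd1 : 0 < d ^ (p - 1) := by positivity
  obtain ⟨β, hβ⟩ : ∃ β, β = (s ^ p - d ^ p) / d := ⟨_, rfl⟩
  have hβd : β * d = s ^ p - d ^ p := by rw [hβ]; field_simp
  have hβa : a ^ p = s ^ p + β * a := by
    have : d * (a ^ p) = d * (s ^ p + β * a) := by linear_combination heq - a * hβd
    exact mul_left_cancel₀ hd0.ne' this
  obtain ⟨γ, hγ⟩ : ∃ γ, γ = p * a ^ (p - 1) - β := ⟨_, rfl⟩
  have hγ0 : 0 < γ := by
    have h1 : 0 < γ * a := by
      have : γ * a = p * a ^ p - (a ^ p - s ^ p) := by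
        rw [hγ]; linear_combination (-p) * had + hβa
      rw [this]; nlinarith
    exact pos_of_mul_pos_left h1 ha.le
  have hind : Integrable ((Set.Ici t).indicator (fun x : ℝ => x - μ - a)) P :=
    ((hi.sub (integrable_const μ)).sub (integrable_const a)).indicator measurableSet_Ici
  have hlin : Integrable (fun x : ℝ => s ^ p + β * (x - μ)) P :=
    (integrable_const _).add ((hi.sub (integrable_const μ)).const_mul β)
  have hpt : ∀ x : ℝ, (s ^ p + β * (x - μ)) +
      γ * (Set.Ici t).indicator (fun x : ℝ => x - μ - a) x ≤ |x - μ| ^ p := by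
    intro x
    by_cases hx : t ≤ x
    · rw [Set.indicator_of_mem (by exact hx)]
      have h := aux_tangent p a (x - μ) hp ha
      have h2 := le_abs_self (x - μ)
      have h3 : p * a ^ (p - 1) * (x - μ) ≤ p * a ^ (p - 1) * |x - μ| :=
        mul_le_mul_of_nonneg_left h2 (by positivity)
      have : (s ^ p + β * (x - μ)) + γ * (x - μ - a)
          = a ^ p + p * a ^ (p - 1) * (x - μ - a) := by
        rw [hγ]; linear_combination -hβa
      linarith
    · rw [Set.indicator_of_notMem (by exact hx)]
      push Not at hx
      have h := aux_tangent p d (x - μ) hp hd0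
      have h2 : |x - μ| = μ - x := by rw [abs_of_neg (by linarith)]; ring
      rw [h2] at h ⊢
      have h4 : 0 ≤ (p * d ^ (p - 1) + β) := by
        have h1 : 0 < (p * d ^ (p - 1) + β) * d := by
          have : (p * d ^ (p - 1) + β) * d = p * d ^ p + (s ^ p - d ^ p) := by
            linear_combination (-p) * hdd + hβd
          rw [this]; nlinarith
        exact (pos_of_mul_pos_left h1 hd0.le).le
      have h5 : 0 ≤ (p * d ^ (p - 1) + β) * (μ - x - d) :=
        mul_nonneg h4 (by linarith)
      linarith
  have hint := integral_mono (hlin.add (hind.const_mul γ)) hip hpt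
  have e1 : ∫ x, ((fun x : ℝ => s ^ p + β * (x - μ)) + fun x =>
      γ * (Set.Ici t).indicator (fun x : ℝ => x - μ - a) x) x ∂P
      = s ^ p + γ * ((∫ x in Set.Ici t, x ∂P) - (μ + a) * (P (Set.Ici t)).toReal) := by
    have hb1 : Integrable (fun x : ℝ => β * (x - μ)) P :=
      (hi.sub (integrable_const μ)).const_mul β
    rw [integral_add' hlin (hind.const_mul γ), integral_const_mul,
      integral_indicator measurableSet_Ici,
      integral_add (integrable_const _) hb1,
      integral_const_mul, integral_sub hi (integrable_const μ), hm]
    have : ∫ x in Set.Ici t, (x - μ - a) ∂P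
       = (∫ x in Set.Ici t, x ∂P) - (μ + a) * (P (Set.Ici t)).toReal := by
      simp_rw [sub_sub]
      rw [integral_sub hi.integrableOn (integrable_const _)]
      simp [measureReal_def, mul_comm]
    rw [this]; simp
  have hle : (∫ x in Set.Ici t, x ∂P) ≤ (μ + a) * (P (Set.Ici t)).toReal := by
    have : γ * ((∫ x in Set.Ici t, x ∂P) - (μ + a) * (P (Set.Ici t)).toReal) ≤ 0 := by
      linarith [e1.symm.le.trans (hint.trans hsp.le)]
    by_contra hcon
    push Not at hcon
    nlinarith [mul_pos hγ0 (sub_pos.2 hcon)]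
  have hpos : 0 < (P (Set.Ici t)).toReal := by
    rcases (ENNReal.toReal_nonneg (a := P (Set.Ici t))).lt_or_eq with h | h
    · exact h
    exfalso
    have h0 : P (Set.Ici t) = 0 := by
      rcases (ENNReal.toReal_eq_zero_iff _).1 h.symm with h | h
      · exact h
      · exact absurd h (measure_ne_top _ _)
    have hae : ∀ᵐ x ∂P, x ≤ t := by
      have : ∀ᵐ x ∂P, x ∉ Set.Ici t := measure_eq_zero_iff_ae_notMem.1 h0
      filter_upwards [this] with x hx
      exact (not_le.1 hx).le
    have := integral_mono_ae hi (integrable_const t) hae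
    simp [hm] at this
    linarith
  rw [div_le_iff₀ hpos]
  exact hle

lemma aux_two_s8 (μ p s t b n : ℝ) (hb : 0 < b) (hn : μ - t < n) (ht : t < μ)
    (h : n * b ^ p + n ^ p * b - s ^ p * (b + n) = 0) :
    ∃ P : Measure ℝ, memAmbPow μ p s P ∧
        μ + b = (∫ x in Set.Ici t, x ∂P) / (P (Set.Ici t)).toReal := by
  have hn0 : 0 < n := by linarith
  have hw1 : 0 < n / (b + n) := by positivity
  have hw2 : 0 < b / (b + n) := by positivity
  have key : ∀ f : ℝ → ℝ, Integrable f
      (ENNReal.ofReal (n / (b + n)) • Measure.dirac (μ + b) +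
      ENNReal.ofReal (b / (b + n)) • Measure.dirac (μ - n)) ∧
      ∫ x, f x ∂(ENNReal.ofReal (n / (b + n)) • Measure.dirac (μ + b) +
      ENNReal.ofReal (b / (b + n)) • Measure.dirac (μ - n))
      = n / (b + n) * f (μ + b) + b / (b + n) * f (μ - n) := by
    intro f
    have i1 : Integrable f (ENNReal.ofReal (n / (b + n)) • Measure.dirac (μ + b)) :=
      (integrable_dirac (by simp)).smul_measure ENNReal.ofReal_ne_top
    have i2 : Integrable f (ENNReal.ofReal (b / (b + n)) • Measure.dirac (μ - n)) :=
      (integrable_dirac (by simp)).smul_measure ENNReal.ofReal_ne_top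
    refine ⟨i1.add_measure i2, ?_⟩
    rw [integral_add_measure i1 i2, integral_smul_measure, integral_smul_measure,
      integral_dirac, integral_dirac, ENNReal.toReal_ofReal hw1.le, ENNReal.toReal_ofReal hw2.le]
    simp
  refine ⟨_, ⟨⟨?_⟩, (key _).1, ?_, (key _).1, ?_⟩, ?_⟩
  · simp only [Measure.add_apply, Measure.smul_apply, measure_univ, smul_eq_mul, mul_one]
    rw [← ENNReal.ofReal_add hw1.le hw2.le, ← add_div, add_comm n b, div_self (by positivity)]
    simp
  · rw [(key _).2]; field_simp; ring
  · rw [(key _).2]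
    have e1 : |μ + b - μ| = b := by rw [add_sub_cancel_left, abs_of_pos hb]
    have e2 : |μ - n - μ| = n := by rw [sub_sub_cancel_left, abs_neg, abs_of_pos hn0]
    rw [e1, e2]; field_simp; linarith
  · have m1 : μ + b ∈ Set.Ici t := by simp; linarith
    have m2 : μ - n ∉ Set.Ici t := by simp; linarith
    rw [← integral_indicator measurableSet_Ici, (key _).2, Set.indicator_of_mem m1,
      Set.indicator_of_notMem m2]
    simp only [Measure.add_apply, Measure.smul_apply, smul_eq_mul,
      Measure.dirac_apply' _ measurableSet_Ici, Set.indicator_of_mem m1,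
      Set.indicator_of_notMem m2]
    simp only [Pi.one_apply, mul_one, mul_zero, add_zero, ENNReal.toReal_ofReal hw1.le]
    field_simp

lemma aux_lower (μ p s t : ℝ) (hp : 1 < p) (hs : 0 < s) (ht : t < μ)
    (a : ℝ) (ha : 0 < a)
    (heq : (μ - t) * a ^ p + ((μ - t) ^ p - s ^ p) * a - (μ - t) * s ^ p = 0)
    (b : ℝ) (hb : 0 < b) (hba : b < a) :
    ∃ P : Measure ℝ, memAmbPow μ p s P ∧
        μ + b = (∫ x in Set.Ici t, x ∂P) / (P (Set.Ici t)).toReal := by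
  obtain ⟨d, hd⟩ : ∃ d, d = μ - t := ⟨_, rfl⟩
  rw [← hd] at heq
  have hd0 : 0 < d := by linarith
  have hsp0 : 0 < s ^ p := by positivity
  have pw : ∀ x : ℝ, 0 < x → x ^ p = x * x ^ (p - 1) := by
    intro x hx
    rw [Real.rpow_sub_one hx.ne']; field_simp
  have hfd : d * b ^ p + d ^ p * b - s ^ p * (b + d) < 0 := by
    have h1 : b ^ (p - 1) ≤ a ^ (p - 1) :=
      Real.rpow_le_rpow hb.le hba.le (by linarith)
    have h2 : a * b ^ p ≤ b * a ^ p := by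
      rw [pw b hb, pw a ha]
      nlinarith [mul_le_mul_of_nonneg_left h1 (mul_pos ha hb).le]
    have h3 : a * (d * b ^ p + d ^ p * b - s ^ p * (b + d)) < 0 := by
      have : a * (d * b ^ p + d ^ p * b - s ^ p * (b + d))
        = d * (a * b ^ p - b * a ^ p) - d * s ^ p * (a - b) := by
        linear_combination b * heq
      rw [this]
      have h4 : 0 < d * s ^ p * (a - b) := mul_pos (mul_pos hd0 hsp0) (by linarith)
      have h5 : 0 ≤ d * (b * a ^ p - a * b ^ p) := mul_nonneg hd0.le (by linarith)
      linarith
    by_contra hc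
    push Not at hc
    nlinarith [mul_nonneg ha.le hc]
  obtain ⟨N, hN1, hN2⟩ := (((tendsto_rpow_atTop (y := p - 1) (by linarith)).eventually_ge_atTop
    (s ^ p * (b / d + 1) / b)).and (Filter.eventually_ge_atTop d)).exists
  have hN0 : 0 < N := by linarith
  have hfN : 0 ≤ N * b ^ p + N ^ p * b - s ^ p * (b + N) := by
    rw [div_le_iff₀ hb] at hN1
    have h1 : N * (s ^ p * (b / d + 1)) ≤ N ^ p * b := by
      rw [pw N hN0]
      nlinarith [mul_le_mul_of_nonneg_left hN1 hN0.le]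
    have h2 : b ≤ N * (b / d) := by
      rw [mul_div_assoc', le_div_iff₀ hd0]; nlinarith
    have h3 : s ^ p * (b + N) ≤ s ^ p * (N * (b / d) + N) :=
      mul_le_mul_of_nonneg_left (by linarith) hsp0.le
    have h4 : 0 ≤ N * b ^ p := by positivity
    nlinarith
  have hc : ContinuousOn (fun n : ℝ => n * b ^ p + n ^ p * b - s ^ p * (b + n)) (Set.Icc d N) := by
    have : Continuous (fun n : ℝ => n ^ p) := Real.continuous_rpow_const (by linarith)
    fun_prop
  obtain ⟨n, hn, hn0⟩ := intermediate_value_Icc hN2 hc ⟨hfd.le, hfN⟩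
  simp only at hn0
  have hdn : d < n := by
    rcases hn.1.lt_or_eq with h | h
    · exact h
    · rw [← h] at hn0; linarith
  exact aux_two_s8 μ p s t b n hb (hd ▸ hdn) ht hn0

/-- Tight upper bound for `E_P(X | X ≥ t)` over the `p`th power deviation
ambiguity set, for `t < μ`. -/
theorem stmt8 (μ p s t : ℝ) (hp : 1 < p) (hs : 0 < s) (ht : t < μ)
    (a : ℝ) (ha : 0 < a)
    (heq : (μ - t) * a ^ p + ((μ - t) ^ p - s ^ p) * a - (μ - t) * s ^ p = 0)
    (huniq : ∀ b : ℝ, 0 < b →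
      (μ - t) * b ^ p + ((μ - t) ^ p - s ^ p) * b - (μ - t) * s ^ p = 0 → b = a) :
    sSup {y : ℝ | ∃ P : Measure ℝ, memAmbPow μ p s P ∧
        y = (∫ x in Set.Ici t, x ∂P) / (P (Set.Ici t)).toReal} = μ + a := by
  apply csSup_eq_of_forall_le_of_forall_lt_exists_gt
  · exact ⟨μ + a / 2, aux_lower μ p s t hp hs ht a ha heq (a / 2) (by linarith) (by linarith)⟩
  · rintro y ⟨P, hP, rfl⟩
    exact aux_upper_s8 μ p s t hp hs ht a ha heq P hP
  · intro w hw
    obtain ⟨b, hb1, hb2⟩ := exists_between (max_lt ha (show w - μ < a by linarith))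
    obtain ⟨h1, h2⟩ := max_lt_iff.1 hb1
    exact ⟨μ + b, aux_lower μ p s t hp hs ht a ha heq b h1 hb2, by linarith⟩
end

section
/- Let μ ∈ ℝ, σ > 0 and t < μ. Then sup over P ∈ P(μ,σ²) of E_P(X | X ≥ t) equals μ + σ²/(μ − t). -/
open MeasureTheory

/-- Membership in the mean-variance ambiguity set `P(μ,σ²)` (second argument is `σ²`). -/
def memMV (μ σ2 : ℝ) (P : Measure ℝ) : Prop :=
  IsProbabilityMeasure P ∧ Integrable (fun x : ℝ => x) P ∧ (∫ x, x ∂P) = μ ∧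
  Integrable (fun x : ℝ => (x - μ) ^ 2) P ∧ (∫ x, (x - μ) ^ 2 ∂P) = σ2

lemma stmt9_upper (μ σ t : ℝ) (hσ : 0 < σ) (ht : t < μ) (P : Measure ℝ) (h : memMV μ (σ ^ 2) P) :
    (∫ x in Set.Ici t, x ∂P) / (P (Set.Ici t)).toReal ≤ μ + σ ^ 2 / (μ - t) := by
  obtain ⟨hP, hi, hm, hi2, hv⟩ := h
  have hd : 0 < μ - t := sub_pos.2 ht
  set d := μ - t with hdd
  obtain ⟨r, hr⟩ : ∃ r, r = σ ^ 2 / d := ⟨_, rfl⟩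
  have hr0 : 0 < r := by rw [hr]; positivity
  have hrd : r * d = σ ^ 2 := by rw [hr]; field_simp
  rw [← hr]
  have hpos : 0 < (P (Set.Ici t)).toReal := by
    rw [ENNReal.toReal_pos_iff]
    refine ⟨?_, measure_lt_top _ _⟩
    rw [pos_iff_ne_zero]
    intro h0
    have hae : ∀ᵐ x ∂P, x ≤ t := by
      have : ∀ᵐ x ∂P, x ∉ Set.Ici t := measure_eq_zero_iff_ae_notMem.1 h0
      filter_upwards [this] with x hx
      exact le_of_lt (by simpa using hx)
    have := integral_mono_ae hi (integrable_const t) hae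
    simp [hm] at this
    linarith
  rw [div_le_iff₀ hpos]
  have hq : Integrable (fun x : ℝ => (1 / (r + d)) * ((x - μ) ^ 2 + (d - r) * (x - μ) - r * d)) P :=
    ((hi2.add ((hi.sub (integrable_const μ)).const_mul (d - r))).sub
      (integrable_const (r * d))).const_mul _
  have hiY : Integrable (fun x : ℝ => (d - r) * (x - μ)) P :=
    (hi.sub (integrable_const μ)).const_mul (d - r)
  have hi3 : Integrable (fun x : ℝ => (x - μ) ^ 2 + (d - r) * (x - μ)) P := hi2.add hiY
  have hint : ∫ x, (1 / (r + d)) * ((x - μ) ^ 2 + (d - r) * (x - μ) - r * d) ∂P = 0 := by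
    rw [integral_const_mul, integral_sub hi3 (integrable_const _),
      integral_add hi2 hiY, integral_const_mul, integral_sub hi (integrable_const _), hm, hv]
    simp [hrd]
  have hle : ∫ x, (Set.Ici t).indicator (fun x => x - (μ + r)) x ∂P ≤ 0 := by
    rw [← hint]
    refine integral_mono ((hi.sub (integrable_const _)).indicator measurableSet_Ici) hq ?_
    intro x
    have hrd' : 0 < r + d := by positivity
    by_cases hx : t ≤ x
    · simp only [Set.indicator, Set.mem_Ici, hx, if_true]
      rw [one_div, inv_mul_eq_div, le_div_iff₀ hrd']
      nlinarith [sq_nonneg (x - μ - r)]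
    · simp only [Set.indicator, Set.mem_Ici, hx, if_false]
      push Not at hx
      have h1 : x - μ + d < 0 := by rw [hdd]; linarith
      have h2 : x - μ - r < 0 := by linarith
      apply mul_nonneg (by positivity)
      nlinarith [mul_pos_of_neg_of_neg h1 h2]
  rw [integral_indicator measurableSet_Ici, integral_sub hi.integrableOn
    (integrable_const _)] at hle
  simp [Measure.real] at hle
  linarith

lemma stmt9_lower (μ σ t c : ℝ) (hσ : 0 < σ) (ht : t < μ) (hc : μ - t < c) :
    ∃ P : Measure ℝ, memMV μ (σ ^ 2) P ∧
      μ + σ ^ 2 / c = (∫ x in Set.Ici t, x ∂P) / (P (Set.Ici t)).toReal := by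
  have hc0 : 0 < c := by linarith
  obtain ⟨r, hr⟩ : ∃ r, r = σ ^ 2 / c := ⟨_, rfl⟩
  have hr0 : 0 < r := by rw [hr]; positivity
  have hrc : r * c = σ ^ 2 := by rw [hr]; field_simp
  rw [← hr]
  have ha : 0 ≤ r / (r + c) := by positivity
  have hb : 0 < c / (r + c) := by positivity
  have hab : r / (r + c) + c / (r + c) = 1 := by field_simp
  let P : Measure ℝ := ENNReal.ofReal (r / (r + c)) • Measure.dirac (μ - c) +
    ENNReal.ofReal (c / (r + c)) • Measure.dirac (μ + r)
  have hI : ∀ f : ℝ → ℝ, Integrable f P := fun f =>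
    ((integrable_dirac (by simp)).smul_measure (by simp)).add_measure
      ((integrable_dirac (by simp)).smul_measure (by simp))
  have hE : ∀ f : ℝ → ℝ, ∫ x, f x ∂P = r / (r + c) * f (μ - c) + c / (r + c) * f (μ + r) := by
    intro f
    rw [integral_add_measure ((integrable_dirac (by simp)).smul_measure (by simp))
      ((integrable_dirac (by simp)).smul_measure (by simp)), integral_smul_measure,
      integral_smul_measure, integral_dirac, integral_dirac, ENNReal.toReal_ofReal ha,
      ENNReal.toReal_ofReal hb.le]
    simp
  have h1 : ¬ (t ≤ μ - c) := by linarith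
  have h2 : t ≤ μ + r := by linarith
  have hA : (P (Set.Ici t)).toReal = c / (r + c) := by
    simp [P, Set.indicator, h1, h2, hb.le]
  refine ⟨P, ⟨⟨?_⟩, hI _, ?_, hI _, ?_⟩, ?_⟩
  · simp [P, ← ENNReal.ofReal_add ha hb.le, hab]
  · rw [hE]; field_simp; ring
  · rw [hE, ← hrc]; field_simp; ring
  · rw [← integral_indicator measurableSet_Ici, hE, hA]
    simp only [Set.indicator, Set.mem_Ici, h1, h2, if_true, if_false]
    field_simp; ring

/-- Tight upper bound of Mallows–Richter for the conditional expectation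
over the mean-variance ambiguity set: for `t < μ`,
`sup E_P(X | X ≥ t) = μ + σ²/(μ - t)`. -/
theorem stmt9 (μ σ t : ℝ) (hσ : 0 < σ) (ht : t < μ) :
    sSup {y : ℝ | ∃ P : Measure ℝ, memMV μ (σ ^ 2) P ∧
        y = (∫ x in Set.Ici t, x ∂P) / (P (Set.Ici t)).toReal} =
      μ + σ ^ 2 / (μ - t) := by
  have hd : 0 < μ - t := sub_pos.2 ht
  apply csSup_eq_of_forall_le_of_forall_lt_exists_gt
  · obtain ⟨P, hP⟩ := stmt9_lower μ σ t (μ - t + 1) hσ ht (by linarith)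
    exact ⟨_, P, hP⟩
  · rintro y ⟨P, hP, rfl⟩
    exact stmt9_upper μ σ t hσ ht P hP
  · intro w hw
    have hcont : ContinuousAt (fun c : ℝ => μ + σ ^ 2 / c) (μ - t) :=
      continuousAt_const.add (continuousAt_const.div continuousAt_id hd.ne')
    have hev : ∀ᶠ c in nhdsWithin (μ - t) (Set.Ioi (μ - t)), w < μ + σ ^ 2 / c :=
      (hcont.eventually (lt_mem_nhds hw)).filter_mono nhdsWithin_le_nhds
    obtain ⟨c, hc, hc'⟩ := (hev.and self_mem_nhdsWithin).exists
    obtain ⟨P, hP⟩ := stmt9_lower μ σ t c hσ ht hc'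
    exact ⟨_, ⟨P, hP⟩, hc⟩
end

section
/- Let μ ∈ ℝ and 0 < d < 2μ. Then for every t < μ − d/2, the supremum over P ∈ P(μ,d) of E_P(X | X ≥ t) equals μ + (μ − t)·d / (2(μ − t) − d). -/
open MeasureTheory

theorem stmt10_upper (μ d t : ℝ) (ht : t < μ - d / 2) (P : Measure ℝ)
    (h : memMAD μ d P) (hd0 : 0 < d) :
    (∫ x in Set.Ici t, x ∂P) / (P (Set.Ici t)).toReal ≤
      μ + (μ - t) * d / (2 * (μ - t) - d) := by
  obtain ⟨hP, hi, hm, hai, hmad⟩ := h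
  have hms : MeasurableSet (Set.Ici t) := measurableSet_Ici
  have hsum := integral_add_compl hms hi
  have hpr := measureReal_add_measureReal_compl (μ := P) hms
  rw [probReal_univ] at hpr
  rw [Set.compl_Ici] at hsum hpr
  have hdi : Integrable (fun x : ℝ => μ - x) P := (integrable_const μ).sub hi
  have hA : ∫ x in Set.Iio t, (μ - x) ∂P = P.real (Set.Iio t) * μ - ∫ x in Set.Iio t, x ∂P := by
    rw [integral_sub (integrable_const μ) hi.integrableOn]
    simp
  have hA1 : (μ - t) * P.real (Set.Iio t) ≤ ∫ x in Set.Iio t, (μ - x) ∂P := by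
    have : ∫ x in Set.Iio t, (μ - t) ∂P ≤ ∫ x in Set.Iio t, (μ - x) ∂P := by
      apply setIntegral_mono_on (integrable_const _) hdi.integrableOn measurableSet_Iio
      intro x hx
      have : x < t := hx
      linarith
    simpa [mul_comm] using this
  have hA2 : ∫ x in Set.Iio t, (μ - x) ∂P ≤ d / 2 := by
    have h1 : ∫ x in Set.Iio t, (μ - x) ∂P ≤ ∫ x, (|x - μ| + (μ - x)) / 2 ∂P := by
      rw [← integral_indicator measurableSet_Iio]
      apply integral_mono (hdi.indicator measurableSet_Iio) ((hai.add hdi).div_const 2)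
      intro x
      by_cases hx : x ∈ Set.Iio t
      · simp only [Set.indicator_of_mem hx, Pi.add_apply]
        have := neg_le_abs (x - μ)
        linarith
      · simp only [Set.indicator_of_notMem hx, Pi.add_apply]
        have := le_abs_self (x - μ)
        linarith
    rw [integral_div, integral_add hai hdi, integral_sub (integrable_const μ) hi, hmad, hm] at h1
    simpa using h1
  change _ / P.real (Set.Ici t) ≤ _
  rw [hA] at hA1 hA2
  rw [hm] at hsum
  set p := P.real (Set.Ici t)
  set r := P.real (Set.Iio t)
  set I := ∫ x in Set.Ici t, x ∂P
  set J := ∫ x in Set.Iio t, x ∂P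
  have hs : 0 < 2 * (μ - t) - d := by linarith
  have hp : 0 < p := by
    by_contra hc
    have : 1 ≤ r := by linarith
    nlinarith
  have hJ : J = μ - I := by linarith
  have hr : r = 1 - p := by linarith
  rw [hJ, hr] at hA1 hA2
  have hb : I - μ * p ≤ d / 2 := by linarith
  have ha : (μ - t) * (1 - p) ≤ I - μ * p := by linarith
  rw [div_le_iff₀ hp, add_mul, ← sub_le_iff_le_add', div_mul_eq_mul_div, le_div_iff₀ hs]
  nlinarith

theorem stmt10_lower (μ d t s : ℝ) (hd0 : 0 < d) (hs : d / 2 < s) (hst : μ - s < t)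
    (ht : t < μ) :
    ∃ P : Measure ℝ, memMAD μ d P ∧
      μ + s * d / (2 * s - d) = (∫ x in Set.Ici t, x ∂P) / (P (Set.Ici t)).toReal := by
  have hs0 : 0 < s := by linarith
  have hsd : 0 < 2 * s - d := by linarith
  set q : ℝ := d / (2 * s) with hq
  set b : ℝ := μ + s * d / (2 * s - d) with hb
  have hq0 : 0 ≤ q := by positivity
  have hq1 : 0 < 1 - q := by
    have : q < 1 := by rw [hq, div_lt_one (by positivity)]; linarith
    linarith
  have hbμ : 0 < b - μ := by
    have : 0 < s * d / (2 * s - d) := by positivity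
    linarith
  have hqs : q * s = d / 2 := by rw [hq]; field_simp
  have hqb : (1 - q) * (b - μ) = d / 2 := by
    rw [hq, hb]; field_simp; ring
  have hint : ∀ f : ℝ → ℝ, ∀ (a c : ℝ), Integrable f (ENNReal.ofReal c • Measure.dirac a) :=
    fun f a c => (integrable_dirac (by simp)).smul_measure ENNReal.ofReal_ne_top
  have hI : ∀ f : ℝ → ℝ, Integrable f
      (ENNReal.ofReal q • Measure.dirac (μ - s) + ENNReal.ofReal (1 - q) • Measure.dirac b) :=
    fun f => (hint _ _ _).add_measure (hint _ _ _)
  have hE : ∀ f : ℝ → ℝ, ∫ x, f x ∂(ENNReal.ofReal q • Measure.dirac (μ - s)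
      + ENNReal.ofReal (1 - q) • Measure.dirac b) = q * f (μ - s) + (1 - q) * f b := by
    intro f
    rw [integral_add_measure (hint _ _ _) (hint _ _ _), integral_smul_measure,
      integral_smul_measure, integral_dirac, integral_dirac, ENNReal.toReal_ofReal hq0,
      ENNReal.toReal_ofReal hq1.le]
    simp
  refine ⟨_, ⟨⟨?_⟩, hI _, ?_, hI _, ?_⟩, ?_⟩
  · simp [← ENNReal.ofReal_add hq0 hq1.le]
  · rw [hE]; linarith
  · rw [hE, abs_of_pos hbμ, abs_of_neg (by linarith)]; linarith
  · have hbt : t ≤ b := by linarith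
    rw [← integral_indicator measurableSet_Ici, hE]
    have h1 : (μ - s) ∉ Set.Ici t := by simpa using hst
    have h2 : b ∈ Set.Ici t := hbt
    simp only [Set.indicator_of_notMem h1, Set.indicator_of_mem h2, Measure.add_apply,
      Measure.smul_apply, Measure.dirac_apply' _ measurableSet_Ici, smul_eq_mul, Pi.one_apply,
      mul_zero, mul_one, zero_add, ENNReal.toReal_ofReal hq1.le]
    field_simp

/-- Tight upper bound for the conditional expectation over the mean-MAD
ambiguity set: for `t < μ - d/2`,
`sup E_P(X | X ≥ t) = μ + (μ - t)·d / (2(μ - t) - d)`. -/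
theorem stmt10 (μ d : ℝ) (hd0 : 0 < d) (hd2 : d < 2 * μ) :
    ∀ t < μ - d / 2,
      sSup {y : ℝ | ∃ P : Measure ℝ, memMAD μ d P ∧
          y = (∫ x in Set.Ici t, x ∂P) / (P (Set.Ici t)).toReal} =
        μ + (μ - t) * d / (2 * (μ - t) - d) := by
  intro t ht
  have hlow := fun s (h1 : μ - t < s) =>
    stmt10_lower μ d t s hd0 (by linarith) (by linarith) (by linarith)
  apply le_antisymm
  · apply csSup_le
    · exact ⟨_, hlow (μ - t + 1) (by linarith)⟩
    · rintro y ⟨P, hP, rfl⟩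
      exact stmt10_upper μ d t ht P hP hd0
  · have hc : ContinuousAt (fun s : ℝ => μ + s * d / (2 * s - d)) (μ - t) := by
      have : 2 * (μ - t) - d ≠ 0 := by linarith
      fun_prop (disch := assumption)
    have ht2 : Filter.Tendsto (fun s : ℝ => μ + s * d / (2 * s - d)) (nhdsWithin (μ - t) (Set.Ioi (μ - t)))
        (nhds (μ + (μ - t) * d / (2 * (μ - t) - d))) := hc.tendsto.mono_left nhdsWithin_le_nhds
    refine le_of_tendsto ht2 ?_
    filter_upwards [self_mem_nhdsWithin] with s hs
    apply le_csSup
    · refine ⟨μ + (μ - t) * d / (2 * (μ - t) - d), ?_⟩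
      rintro y ⟨P, hP, rfl⟩
      exact stmt10_upper μ d t ht P hP hd0
    · exact hlow s hs
end

section
/- Let μ ∈ ℝ, s > 0, let φ satisfy the assumption on the dispersion function, and let t < μ. Let v2* be the unique v2 > μ satisfying ((v2 − μ)/(v2 − t))·φ(t) + ((μ − t)/(v2 − t))·φ(v2) = s. Then the infimum over P ∈ P(μ,s,φ) of P([t, ∞)) equals (μ − t)/(v2* − t). -/
open MeasureTheory Filter

lemma aux_tangent_s11 {φ : ℝ → ℝ} (hc : StrictConvexOn ℝ Set.univ φ) {v : ℝ}
    (hd : DifferentiableAt ℝ φ v) (x : ℝ) : φ v + deriv φ v * (x - v) ≤ φ x := by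
  rcases lt_trichotomy x v with h | h | h
  · have := hc.convexOn.slope_le_of_hasDerivAt (Set.mem_univ x) (Set.mem_univ v) h hd.hasDerivAt
    rw [slope_def_field, div_le_iff₀ (by linarith)] at this
    linarith
  · subst h; simp
  · have := hc.convexOn.le_slope_of_hasDerivAt (Set.mem_univ v) (Set.mem_univ x) h hd.hasDerivAt
    rw [slope_def_field, le_div_iff₀ (by linarith)] at this
    linarith

/-- chord inequality -/
lemma aux_chord {φ : ℝ → ℝ} (hc : StrictConvexOn ℝ Set.univ φ) {x t v : ℝ}
    (h1 : x < t) (h2 : t < v) : (v - x) * φ t < (v - t) * φ x + (t - x) * φ v := by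
  have hx : 0 < v - x := by linarith
  have := hc.2 (Set.mem_univ x) (Set.mem_univ v) (by linarith)
    (div_pos (show 0 < v - t by linarith) hx) (div_pos (show 0 < t - x by linarith) hx)
    (by field_simp; ring)
  simp only [smul_eq_mul] at this
  have e : (v - t) / (v - x) * x + (t - x) / (v - x) * v = t := by field_simp; ring
  rw [e] at this
  have h3 := mul_lt_mul_of_pos_left this hx
  have e2 : (v - x) * ((v - t) / (v - x) * φ x + (t - x) / (v - x) * φ v)
    = (v - t) * φ x + (t - x) * φ v := by field_simp
  linarith

lemma aux_lower_s11 (μ s t : ℝ) (φ : ℝ → ℝ) (hφ : DispersionOK μ φ) (ht : t < μ)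
    (v : ℝ) (hv : μ < v)
    (heq : (v - μ) / (v - t) * φ t + (μ - t) / (v - t) * φ v = s)
    (P : Measure ℝ) (hP : memAmb μ s φ P) :
    (μ - t) / (v - t) ≤ (P (Set.Ici t)).toReal := by
  obtain ⟨hp, hi, hm, hiφ, hmφ⟩ := hP
  have hc := hφ.strict_convex
  have htan := aux_tangent_s11 hc (hφ.diff v hv.ne')
  set d := deriv φ v
  have hvt : 0 < v - t := by linarith
  set D := φ t - φ v - d * (t - v) with hD
  have hDpos : 0 < D := by
    have h1 := htan ((t + v) / 2)
    have h2 := aux_chord hc (x := t) (t := (t + v) / 2) (v := v) (by linarith) (by linarith)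
    have h3 := mul_le_mul_of_nonneg_left h1 hvt.le
    have h4 : 0 < (v - t) * D := by rw [hD]; nlinarith
    exact pos_of_mul_pos_right h4 hvt.le
  have hpt : ∀ x, 1 - (φ x - φ v - d * (x - v)) / D ≤ (Set.Ici t).indicator (fun _ => (1:ℝ)) x := by
    intro x
    by_cases hx : t ≤ x
    · rw [Set.indicator_of_mem (by simpa using hx)]
      have := htan x
      have : 0 ≤ (φ x - φ v - d * (x - v)) / D := div_nonneg (by linarith) hDpos.le
      linarith
    · rw [Set.indicator_of_notMem (by simpa using hx)]
      push Not at hx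
      have h1 := aux_chord hc hx (show t < v by linarith)
      have h2 := htan x
      have : 1 ≤ (φ x - φ v - d * (x - v)) / D := by
        rw [le_div_iff₀ hDpos, one_mul]
        have h3 : 0 ≤ (t - x) * (φ x - (φ v + d * (x - v))) :=
          mul_nonneg (by linarith) (by linarith)
        have h4 : 0 ≤ (v - x) * ((φ x - φ v - d * (x - v)) - D) := by rw [hD]; nlinarith
        have := nonneg_of_mul_nonneg_right h4 (show 0 < v - x by linarith)
        linarith
      linarith
  have i1 : Integrable (fun x => φ x - φ v) P := hiφ.sub (integrable_const _)
  have i2 : Integrable (fun x => d * (x - v)) P := (hi.sub (integrable_const _)).const_mul d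
  have i3 : Integrable (fun x => (φ x - φ v - d * (x - v)) / D) P := (i1.sub i2).div_const D
  have i4 : Integrable (fun x => 1 - (φ x - φ v - d * (x - v)) / D) P := (integrable_const _).sub i3
  have hint := integral_mono i4 ((integrable_const (1:ℝ)).indicator (measurableSet_Ici (a := t))) hpt
  rw [integral_sub (integrable_const _) i3, integral_div, integral_sub i1 i2,
    integral_sub hiφ (integrable_const _), integral_const_mul, integral_sub hi (integrable_const _),
    integral_indicator measurableSet_Ici, hm, hmφ] at hint
  simp only [integral_const, probReal_univ, smul_eq_mul, one_mul, mul_one,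
    measureReal_restrict_apply_univ] at hint
  refine le_trans (le_of_eq ?_) hint
  have e : s - φ v - d * (μ - v) = (v - μ) / (v - t) * D := by
    rw [← heq, hD]; field_simp; ring
  rw [e, mul_div_assoc, div_self hDpos.ne']
  field_simp; ring

lemma aux_mem (μ s t : ℝ) (φ : ℝ → ℝ) (hs : 0 < s) (hφ : DispersionOK μ φ) (ht : t < μ)
    (v : ℝ) (hv : μ < v)
    (heq : (v - μ) / (v - t) * φ t + (μ - t) / (v - t) * φ v = s) (x : ℝ) (hx : x < t)
    (F : ℝ) (hF : F = (v - μ) / (v - x) * φ x + (μ - x) / (v - x) * φ v) :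
    ∃ P : Measure ℝ, memAmb μ s φ P ∧
      s / F * ((μ - x) / (v - x)) + (1 - s / F) = (P (Set.Ici t)).toReal := by
  have hvx : 0 < v - x := by linarith
  have hvt : 0 < v - t := by linarith
  have hFs : s ≤ F := by
    have h := aux_chord hφ.strict_convex hx (show t < v by linarith)
    have h2 := mul_le_mul_of_nonneg_left h.le (show 0 ≤ v - μ by linarith)
    have : F - s = ((v - μ) * ((v - t) * φ x + (t - x) * φ v) - (v - μ) * ((v - x) * φ t))
        / ((v - t) * (v - x)) := by
      rw [hF, ← heq]; field_simp; ring
    have : 0 ≤ F - s := by rw [this]; exact div_nonneg (by linarith) (by positivity)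
    linarith
  have hFpos : 0 < F := by linarith
  set l := s / F with hl
  have hl0 : 0 ≤ l := by positivity
  have hl1 : l ≤ 1 := (div_le_one hFpos).2 hFs
  have ha : 0 ≤ l * ((v - μ) / (v - x)) := mul_nonneg hl0 (div_nonneg (by linarith) hvx.le)
  have hb : 0 ≤ l * ((μ - x) / (v - x)) := mul_nonneg hl0 (div_nonneg (by linarith) hvx.le)
  have hc : 0 ≤ 1 - l := by linarith
  have hsum : l * ((v - μ) / (v - x)) + l * ((μ - x) / (v - x)) + (1 - l) = 1 := by
    field_simp; ring
  have hmean : l * ((v - μ) / (v - x)) * x + l * ((μ - x) / (v - x)) * v + (1 - l) * μ = μ := by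
    field_simp; ring
  have hphi : l * ((v - μ) / (v - x)) * φ x + l * ((μ - x) / (v - x)) * φ v + (1 - l) * φ μ = s := by
    rw [hφ.zero]
    have : l * F = s := by rw [hl]; field_simp
    rw [← this, hF]; ring
  generalize l * ((v - μ) / (v - x)) = a at *
  generalize l * ((μ - x) / (v - x)) = b at *
  generalize 1 - l = c at *
  have hint : ∀ f : ℝ → ℝ, ∀ y r, Integrable f (ENNReal.ofReal r • Measure.dirac y) := fun f y r =>
    (integrable_dirac (by simp)).smul_measure (by simp)
  have hI : ∀ f : ℝ → ℝ, Integrable f (ENNReal.ofReal a • Measure.dirac x +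
      ENNReal.ofReal b • Measure.dirac v + ENNReal.ofReal c • Measure.dirac μ) ∧
      ∫ y, f y ∂(ENNReal.ofReal a • Measure.dirac x +
      ENNReal.ofReal b • Measure.dirac v + ENNReal.ofReal c • Measure.dirac μ) =
      a * f x + b * f v + c * f μ := by
    intro f
    refine ⟨((hint f _ _).add_measure (hint f _ _)).add_measure (hint f _ _), ?_⟩
    rw [integral_add_measure ((hint f _ _).add_measure (hint f _ _)) (hint f _ _),
      integral_add_measure (hint f _ _) (hint f _ _)]
    simp only [integral_smul_measure, integral_dirac, ENNReal.toReal_ofReal ha,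
      ENNReal.toReal_ofReal hb, ENNReal.toReal_ofReal hc, smul_eq_mul]
  refine ⟨_, ⟨⟨?_⟩, (hI _).1, (hI _).2.trans hmean, (hI _).1, (hI _).2.trans hphi⟩, ?_⟩
  · simp only [Measure.add_apply, Measure.smul_apply, measure_univ, smul_eq_mul, mul_one]
    rw [← ENNReal.ofReal_add ha hb, ← ENNReal.ofReal_add (by linarith) hc, hsum, ENNReal.ofReal_one]
  · simp only [Measure.add_apply, Measure.smul_apply, smul_eq_mul,
      Measure.dirac_apply' _ (measurableSet_Ici (a := t))]
    rw [Set.indicator_of_notMem (by simpa using hx),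
      Set.indicator_of_mem (by simp; linarith), Set.indicator_of_mem (by simp; linarith)]
    simp only [Pi.one_apply, mul_zero, mul_one, zero_add]
    rw [← ENNReal.ofReal_add hb hc, ENNReal.toReal_ofReal (by linarith)]

/-- Tight lower bound for the tail probability `P([t,∞))` over the
ambiguity set `P(μ,s,φ)`, for `t < μ`. -/
theorem stmt11 (μ s t : ℝ) (φ : ℝ → ℝ) (hs : 0 < s) (hφ : DispersionOK μ φ)
    (ht : t < μ)
    (v2s : ℝ) (hv2s : μ < v2s)
    (heq : (v2s - μ) / (v2s - t) * φ t + (μ - t) / (v2s - t) * φ v2s = s)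
    (huniq : ∀ u, μ < u →
      (u - μ) / (u - t) * φ t + (μ - t) / (u - t) * φ u = s → u = v2s) :
    sInf {y : ℝ | ∃ P : Measure ℝ, memAmb μ s φ P ∧ y = (P (Set.Ici t)).toReal} =
      (μ - t) / (v2s - t) := by
  have hvt : 0 < v2s - t := by linarith
  apply csInf_eq_of_forall_ge_of_forall_gt_exists_lt
  · obtain ⟨P, hP, h⟩ := aux_mem μ s t φ hs hφ ht v2s hv2s heq (t - 1) (by linarith) _ rfl
    exact ⟨_, P, hP, rfl⟩
  · rintro y ⟨P, hP, rfl⟩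
    exact aux_lower_s11 μ s t φ hφ ht v2s hv2s heq P hP
  · intro w hw
    have hcφ : ContinuousAt φ t := (hφ.diff t ht.ne).continuousAt
    have c1 : ContinuousAt (fun x => (v2s - μ) / (v2s - x) * φ x + (μ - x) / (v2s - x) * φ v2s) t := by
      have : v2s - t ≠ 0 := hvt.ne'
      fun_prop (disch := assumption)
    have c2 : ContinuousAt (fun x => s / ((v2s - μ) / (v2s - x) * φ x + (μ - x) / (v2s - x) * φ v2s)) t :=
      continuousAt_const.div c1 (by simp only [heq]; exact hs.ne')
    have c3 : ContinuousAt (fun x => (μ - x) / (v2s - x)) t := by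
      have : v2s - t ≠ 0 := hvt.ne'
      fun_prop (disch := assumption)
    have c4 := (c2.mul c3).add (continuousAt_const (y := (1:ℝ)) |>.sub c2)
    have hev := c4.eventually_lt (continuousAt_const (y := w)) (by
      simp only [Pi.add_apply, Pi.mul_apply, Pi.sub_apply, heq, div_self hs.ne']
      linarith)
    have hev2 := (hev.filter_mono nhdsWithin_le_nhds).and
      (self_mem_nhdsWithin : Set.Iio t ∈ nhdsWithin t (Set.Iio t))
    obtain ⟨x, hx1, hx2⟩ := hev2.exists
    obtain ⟨P, hP, h⟩ := aux_mem μ s t φ hs hφ ht v2s hv2s heq x hx2 _ rfl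
    exact ⟨_, ⟨P, hP, rfl⟩, by rw [← h]; exact hx1⟩
end

section
/- Let μ ∈ ℝ, d > 0 and t < μ − d/2. Then the infimum over P ∈ P(μ,d) of P([t, ∞)) equals 1 − d/(2(μ − t)). -/
open MeasureTheory

/-- Tight lower bound on the tail probability over the mean-MAD
ambiguity set: for `t < μ - d/2`, `inf P([t,∞)) = 1 - d/(2(μ - t))`. -/
theorem stmt14 (μ d t : ℝ) (hd : 0 < d) (ht : t < μ - d / 2) :
    sInf {y : ℝ | ∃ P : Measure ℝ, memMAD μ d P ∧ y = (P (Set.Ici t)).toReal} =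
      1 - d / (2 * (μ - t)) := by
  have hm : 0 < μ - t := by linarith
  have hp0 : 0 < d / (2 * (μ - t)) := by positivity
  have hp1 : d / (2 * (μ - t)) < 1 := by
    rw [div_lt_one (by positivity)]; linarith
  have key : ∀ p : ℝ, 0 < p → p < d / (2 * (μ - t)) →
      ∃ P : Measure ℝ, memMAD μ d P ∧ 1 - p = (P (Set.Ici t)).toReal := by
    intro p h0 h1
    have hq : 0 < 1 - p := by linarith
    have hs : μ - d / (2 * p) < t := by
      rw [lt_div_iff₀ (by positivity)] at h1
      have : μ - t < d / (2 * p) := by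
        rw [lt_div_iff₀ (by positivity)]; linarith
      linarith
    have hy0 : 0 < d / (2 * (1 - p)) := by positivity
    have hs0 : 0 < d / (2 * p) := by positivity
    have hint : ∀ f : ℝ → ℝ, Integrable f
        (ENNReal.ofReal p • Measure.dirac (μ - d / (2 * p)) +
          ENNReal.ofReal (1 - p) • Measure.dirac (μ + d / (2 * (1 - p)))) := by
      intro f
      exact ((integrable_dirac (by simp)).smul_measure (by simp)).add_measure
        ((integrable_dirac (by simp)).smul_measure (by simp))
    have hval : ∀ f : ℝ → ℝ, ∫ x, f x ∂(ENNReal.ofReal p • Measure.dirac (μ - d / (2 * p)) +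
          ENNReal.ofReal (1 - p) • Measure.dirac (μ + d / (2 * (1 - p)))) =
          p * f (μ - d / (2 * p)) + (1 - p) * f (μ + d / (2 * (1 - p))) := by
      intro f
      rw [integral_add_measure ((integrable_dirac (by simp)).smul_measure (by simp))
        ((integrable_dirac (by simp)).smul_measure (by simp)), integral_smul_measure,
        integral_smul_measure, integral_dirac, integral_dirac,
        ENNReal.toReal_ofReal h0.le, ENNReal.toReal_ofReal hq.le]
      simp
    refine ⟨_, ⟨⟨?_⟩, hint _, ?_, hint _, ?_⟩, ?_⟩
    · simp only [Measure.add_apply, Measure.smul_apply, measure_univ, smul_eq_mul, mul_one]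
      rw [← ENNReal.ofReal_add h0.le hq.le]; simp
    · rw [hval]; field_simp; ring
    · rw [hval (fun x => |x - μ|)]
      have e1 : |μ - d / (2 * p) - μ| = d / (2 * p) := by
        rw [show μ - d / (2 * p) - μ = - (d / (2 * p)) by ring, abs_neg, abs_of_pos hs0]
      have e2 : |μ + d / (2 * (1 - p)) - μ| = d / (2 * (1 - p)) := by
        rw [show μ + d / (2 * (1 - p)) - μ = d / (2 * (1 - p)) by ring, abs_of_pos hy0]
      simp only [e1, e2]
      field_simp; ring
    · have n1 : μ - d / (2 * p) ∉ Set.Ici t := by simpa using hs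
      have n2 : μ + d / (2 * (1 - p)) ∈ Set.Ici t := by
        simp only [Set.mem_Ici]; linarith
      simp only [Measure.add_apply, Measure.smul_apply, smul_eq_mul,
        Measure.dirac_apply' _ measurableSet_Ici, Set.indicator_of_notMem n1,
        Set.indicator_of_mem n2]
      simp [ENNReal.toReal_ofReal hq.le]
  apply csInf_eq_of_forall_ge_of_forall_gt_exists_lt
  · obtain ⟨P, hP⟩ := key (d / (2 * (μ - t)) / 2) (by linarith) (by linarith)
    exact ⟨_, P, hP⟩
  · rintro y ⟨P, ⟨hP, hi, he, hi2, he2⟩, rfl⟩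
    have hci : Integrable (fun x : ℝ => x - μ) P := hi.sub (integrable_const μ)
    have hle : P.real (Set.Iio t) ≤ ∫ x, (|x - μ| - (x - μ)) / (2 * (μ - t)) ∂P := by
      rw [← integral_indicator_one measurableSet_Iio]
      refine integral_mono ((integrable_const (1:ℝ)).indicator measurableSet_Iio)
        ((hi2.sub hci).div_const _) ?_
      intro x
      by_cases hx : x < t
      · rw [Set.indicator_of_mem (Set.mem_Iio.2 hx)]
        simp only [Pi.one_apply]
        rw [le_div_iff₀ (by positivity), abs_of_neg (by linarith)]
        linarith
      · rw [Set.indicator_of_notMem (by simpa using hx)]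
        exact div_nonneg (sub_nonneg.2 (le_abs_self _)) (by positivity)
    rw [integral_div, integral_sub hi2 hci, integral_sub hi (integrable_const μ), he, he2] at hle
    simp only [integral_const, probReal_univ, smul_eq_mul, one_mul, sub_self, sub_zero] at hle
    have hc := probReal_compl_eq_one_sub (μ := P) (measurableSet_Iio (a := t))
    rw [Set.compl_Iio] at hc
    change _ ≤ P.real (Set.Ici t)
    linarith
  · intro w hw
    obtain ⟨p, hp, hp'⟩ := exists_between (max_lt hp0 (show 1 - w < d / (2 * (μ - t)) by linarith))
    obtain ⟨P, hP⟩ := key p (lt_of_le_of_lt (le_max_left _ _) hp) hp'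
    exact ⟨_, ⟨P, hP⟩, by have := lt_of_le_of_lt (le_max_right _ _) hp; linarith⟩
end

section
/- Let μ ∈ ℝ, s > 0, t ∈ ℝ, and let φ satisfy the assumption on the dispersion function. Then there exists a unique pair (v1, v2) with v1 < μ < v2 satisfying the system (v1 − t)·φ'(v1) − φ(v1) = (v2 − t)·φ'(v2) − φ(v2) and ((v2 − μ)/(v2 − v1))·φ(v1) + ((μ − v1)/(v2 − v1))·φ(v2) = s, and the two-point distribution with data (v1, w1, v2, w2), where w2 = (μ − v1)/(v2 − v1) and w1 = 1 − w2, belongs to P(μ,s,φ) and attains the maximum of E_P[max{X − t, 0}] over all P ∈ P(μ,s,φ). -/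
open MeasureTheory Filter

lemma dok_tangent {μ : ℝ} {φ : ℝ → ℝ} (H : DispersionOK μ φ) {v x : ℝ} (hv : v ≠ μ)
    (hx : x ≠ v) : φ v + deriv φ v * (x - v) < φ x := by
  have hd := (H.diff v hv).hasDerivAt
  rcases lt_or_gt_of_ne hx with h | h
  · have := H.strict_convex.slope_lt_of_hasDerivAt (Set.mem_univ x) (Set.mem_univ v) h hd
    rw [slope_def_field, div_lt_iff₀ (by linarith)] at this
    linarith
  · have := H.strict_convex.lt_slope_of_hasDerivAt (Set.mem_univ v) (Set.mem_univ x) h hd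
    rw [slope_def_field, lt_div_iff₀ (by linarith)] at this
    linarith

lemma dok_deriv_lt {μ : ℝ} {φ : ℝ → ℝ} (H : DispersionOK μ φ) {a b : ℝ} (ha : a ≠ μ)
    (hb : b ≠ μ) (hab : a < b) : deriv φ a < deriv φ b := by
  have h1 := dok_tangent H ha hab.ne'
  have h2 := dok_tangent H hb hab.ne
  nlinarith

lemma dok_cont {μ : ℝ} {φ : ℝ → ℝ} (H : DispersionOK μ φ) : Continuous φ := by
  have := H.strict_convex.convexOn.continuousOn isOpen_univ
  exact continuousOn_univ.1 this

lemma dok_deriv_cont {μ : ℝ} {φ : ℝ → ℝ} (H : DispersionOK μ φ) {a : ℝ} (ha : a ≠ μ) :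
    ContinuousAt (deriv φ) a := by
  have hpos : 0 < |a - μ| := abs_pos.2 (sub_ne_zero.2 ha)
  set e := |a - μ| with he
  have hne : ∀ x ∈ Set.Ioo (a - e) (a + e), x ≠ μ := by
    rintro x ⟨h1, h2⟩ rfl
    rcases abs_cases (a - x) with h | h <;> linarith
  have hmono : StrictMonoOn (deriv φ) (Set.Ioo (a - e) (a + e)) :=
    fun x hx y hy hxy => dok_deriv_lt H (hne x hx) (hne y hy) hxy
  refine hmono.continuousAt_of_image_mem_nhds (Ioo_mem_nhds (by linarith) (by linarith)) ?_
  have hoc : (deriv φ '' Set.Ioo (a - e) (a + e)).OrdConnected :=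
    Set.ordConnected_Ioo.image_deriv (fun x hx => H.diff x (hne x hx))
  have m1 : a - e / 2 ∈ Set.Ioo (a - e) (a + e) := ⟨by linarith, by linarith⟩
  have m2 : a + e / 2 ∈ Set.Ioo (a - e) (a + e) := ⟨by linarith, by linarith⟩
  have m0 : a ∈ Set.Ioo (a - e) (a + e) := ⟨by linarith, by linarith⟩
  exact Filter.mem_of_superset
    (Icc_mem_nhds (hmono m1 m0 (by linarith)) (hmono m0 m2 (by linarith)))
    (hoc.out (Set.mem_image_of_mem _ m1) (Set.mem_image_of_mem _ m2))

lemma dok_growth_right {μ : ℝ} {φ : ℝ → ℝ} (H : DispersionOK μ φ) (K c : ℝ) (hK : 0 ≤ K) :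
    ∃ b, c ≤ b ∧ ∀ x, b ≤ x → K * (x - μ) ≤ φ x := by
  have h1 : Tendsto (fun x : ℝ => |φ x / x|) atTop atTop :=
    H.growth.mono_left (by rw [cocompact_eq_atBot_atTop]; exact le_sup_right)
  obtain ⟨b, hb⟩ := eventually_atTop.1 (h1.eventually_ge_atTop (2 * K))
  refine ⟨max c (max b (|μ| + 1)), le_max_left _ _, fun x hx => ?_⟩
  have hb' := hb x (by simp only [max_le_iff] at hx; exact hx.2.1)
  have hx2 : |μ| + 1 ≤ x := by simp only [max_le_iff] at hx; exact hx.2.2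
  have hxp : 0 < x := by linarith [abs_nonneg μ]
  have hφ : 0 ≤ φ x := by linarith [H.isMin x, H.zero]
  rw [abs_of_nonneg (by positivity), le_div_iff₀ hxp] at hb'
  nlinarith [neg_abs_le μ]

lemma dok_refl {μ : ℝ} {φ : ℝ → ℝ} (H : DispersionOK μ φ) :
    DispersionOK (-μ) (fun x => φ (-x)) where
  strict_convex := by
    refine ⟨convex_univ, fun x _ y _ hxy a b ha hb hab => ?_⟩
    have := H.strict_convex.2 (Set.mem_univ (-x)) (Set.mem_univ (-y)) (by simpa using hxy)
      ha hb hab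
    simp only [smul_eq_mul] at this ⊢
    convert this using 2
    ring
  diff := fun x hx => by
    have : DifferentiableAt ℝ φ (-x) := H.diff (-x) (fun h => hx (by linarith))
    exact this.comp x differentiableAt_id.neg
  growth := by
    have h := H.growth.comp ((Homeomorph.neg ℝ).isClosedEmbedding.tendsto_cocompact)
    refine h.congr fun x => ?_
    simp [abs_div]
  zero := by simpa using H.zero
  isMin := fun x => by simpa using H.isMin (-x)

lemma dok_growth_left {μ : ℝ} {φ : ℝ → ℝ} (H : DispersionOK μ φ) (K c : ℝ) (hK : 0 ≤ K) :
    ∃ a, a ≤ c ∧ ∀ x, x ≤ a → K * (μ - x) ≤ φ x := by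
  obtain ⟨b, hb, h⟩ := dok_growth_right (dok_refl H) K (-c) hK
  refine ⟨-b, by linarith, fun x hx => ?_⟩
  have := h (-x) (by linarith)
  simp only [neg_neg] at this
  linarith

/-- the function in the first order condition -/
noncomputable def gfun (φ : ℝ → ℝ) (t v : ℝ) : ℝ := (v - t) * deriv φ v - φ v

lemma gfun_cont {μ : ℝ} {φ : ℝ → ℝ} (H : DispersionOK μ φ) (t : ℝ) {a : ℝ} (ha : a ≠ μ) :
    ContinuousAt (gfun φ t) a := by
  unfold gfun
  exact ((continuousAt_id.sub continuousAt_const).mul (dok_deriv_cont H ha)).sub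
    (dok_cont H).continuousAt

lemma gfun_gt {μ : ℝ} {φ : ℝ → ℝ} (H : DispersionOK μ φ) (t : ℝ) {a : ℝ} (ha : a ≠ μ)
    (hat : a ≠ t) : -φ t < gfun φ t a := by
  have := dok_tangent H ha hat.symm
  unfold gfun; linarith

lemma gfun_mono {μ : ℝ} {φ : ℝ → ℝ} (H : DispersionOK μ φ) (t : ℝ) {a b : ℝ} (ha : a ≠ μ)
    (hb : b ≠ μ) (hta : t < a) (hab : a < b) : gfun φ t a < gfun φ t b := by
  have h1 := dok_tangent H hb hab.ne
  have h2 := dok_deriv_lt H ha hb hab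
  unfold gfun; nlinarith

lemma gfun_anti {μ : ℝ} {φ : ℝ → ℝ} (H : DispersionOK μ φ) (t : ℝ) {a b : ℝ} (ha : a ≠ μ)
    (hb : b ≠ μ) (hbt : b < t) (hab : a < b) : gfun φ t b < gfun φ t a := by
  have h1 := dok_tangent H ha hab.ne'
  have h2 := dok_deriv_lt H ha hb hab
  unfold gfun; nlinarith

lemma gfun_large_right {μ : ℝ} {φ : ℝ → ℝ} (H : DispersionOK μ φ) (t M c : ℝ) :
    ∃ x, c ≤ x ∧ M < gfun φ t x := by
  obtain ⟨b, hb, h⟩ := dok_growth_right H (|M| + |φ (t+1)| + 1) (max c (max (t+2) (μ+1)))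
    (by positivity)
  simp only [max_le_iff] at hb
  refine ⟨b, hb.1, ?_⟩
  have h0 := h b le_rfl
  have hne : b ≠ μ := by intro h; linarith
  have h1 := dok_tangent H hne (x := μ) hne.symm
  rw [H.zero] at h1
  have h2 := dok_tangent H hne (x := t + 1) (by intro h; linarith)
  have h3 : |M| + |φ (t+1)| + 1 < deriv φ b := by nlinarith
  unfold gfun
  linarith [le_abs_self M, le_abs_self (φ (t+1)), neg_abs_le (φ (t+1))]

lemma gfun_refl (φ : ℝ → ℝ) (t x : ℝ) :
    gfun (fun y => φ (-y)) (-t) x = gfun φ t (-x) := by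
  unfold gfun
  rw [deriv_comp_neg]
  ring

lemma gfun_large_left {μ : ℝ} {φ : ℝ → ℝ} (H : DispersionOK μ φ) (t M c : ℝ) :
    ∃ x, x ≤ c ∧ M < gfun φ t x := by
  obtain ⟨x, hx, h⟩ := gfun_large_right (dok_refl H) (-t) M (-c)
  rw [gfun_refl] at h
  exact ⟨-x, by linarith, h⟩

lemma gfun_surj {μ : ℝ} {φ : ℝ → ℝ} (H : DispersionOK μ φ) {t : ℝ} (ht : μ ≤ t) {z : ℝ}
    (hz : -φ t < z) : ∃ x, t < x ∧ gfun φ t x = z := by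
  obtain ⟨x1, hx1, h1⟩ := gfun_large_right H t z (t + 1)
  have hc : Tendsto (fun x => (x - t) * deriv φ (t + 1) - φ x) (nhdsWithin t (Set.Ioi t))
      (nhds (-φ t)) := by
    have : Continuous (fun x => (x - t) * deriv φ (t + 1) - φ x) := by
      have := dok_cont H
      fun_prop
    have h := this.tendsto t
    simp only [sub_self, zero_mul, zero_sub] at h
    exact h.mono_left nhdsWithin_le_nhds
  have hev := (hc.eventually (gt_mem_nhds hz)).and
    (Ioo_mem_nhdsGT (show t < t + 1 by linarith))
  obtain ⟨x0, h0, hx0, hx0'⟩ := hev.exists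
  have h0' : gfun φ t x0 < z := by
    have := dok_deriv_lt H (a := x0) (b := t + 1) (by intro h; linarith) (by intro h; linarith) hx0'
    unfold gfun; nlinarith
  have hcont : ContinuousOn (gfun φ t) (Set.Ioi t) := fun x hx =>
    (gfun_cont H t (by rintro rfl; exact absurd hx (not_lt.2 ht))).continuousWithinAt
  obtain ⟨x, hx, hxz⟩ := isPreconnected_Ioi.intermediate_value (a := x0) (b := x1) hx0
    (show t < x1 by linarith) hcont ⟨h0'.le, h1.le⟩
  exact ⟨x, hx, hxz⟩

lemma gfun_inv {μ : ℝ} {φ : ℝ → ℝ} (H : DispersionOK μ φ) {t : ℝ} (ht : μ ≤ t) :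
    ∃ V : ℝ → ℝ, Continuous V ∧ StrictMono V ∧
      (∀ z, -φ t < z → t < V z ∧ gfun φ t (V z) = z) ∧ ∀ x, t < x → V (gfun φ t x) = x := by
  classical
  let G : ℝ → ℝ := fun x => if t < x then gfun φ t x else x - t - φ t
  have hmono : StrictMono G := by
    intro a b hab
    by_cases ha : t < a
    · have hb : t < b := by linarith
      simp only [G, ha, hb, if_true]
      exact gfun_mono H t (by intro h; linarith) (by intro h; linarith) ha hab
    · by_cases hb : t < b
      · simp only [G, ha, hb, if_true, if_false]
        have := gfun_gt H t (a := b) (by intro h; linarith) hb.ne'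
        linarith
      · simp only [G, ha, hb, if_false]; linarith
  have hsurj : Function.Surjective G := by
    intro z
    by_cases hz : -φ t < z
    · obtain ⟨x, hx, h⟩ := gfun_surj H ht hz
      exact ⟨x, by simp only [G, hx, if_true, h]⟩
    · refine ⟨z + t + φ t, ?_⟩
      have : ¬ t < z + t + φ t := by linarith
      simp only [G, this, if_false]; ring
  let e := hmono.orderIsoOfSurjective G hsurj
  have he : ∀ x, e x = G x := fun x => rfl
  refine ⟨e.symm, e.symm.continuous, e.symm.strictMono, fun z hz => ?_, fun x hx => ?_⟩
  · obtain ⟨x, hx, h⟩ := gfun_surj H ht hz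
    have : e x = z := by rw [he]; simp only [G, hx, if_true, h]
    have h2 : e.symm z = x := by rw [← this]; simp
    rw [h2]; exact ⟨hx, h⟩
  · have : e x = gfun φ t x := by rw [he]; simp only [G, hx, if_true]
    rw [← this]; simp

lemma exists_right {μ s t : ℝ} {φ : ℝ → ℝ} (hs : 0 < s) (H : DispersionOK μ φ) (ht : μ ≤ t) :
    ∃ v1 v2 : ℝ, v1 < μ ∧ μ < v2 ∧ gfun φ t v1 = gfun φ t v2 ∧
      ((v2 - μ) / (v2 - v1) * φ v1 + (μ - v1) / (v2 - v1) * φ v2 = s) := by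
  obtain ⟨V, hVc, hVm, hV, hV'⟩ := gfun_inv H ht
  have hφ0 : ∀ x, 0 ≤ φ x := fun x => by linarith [H.isMin x, H.zero]
  have hW : ∀ x, x < μ → t < V (gfun φ t x) ∧ gfun φ t (V (gfun φ t x)) = gfun φ t x :=
    fun x hx => hV _ (gfun_gt H t hx.ne (by intro h; linarith))
  let C : ℝ → ℝ := fun x => (V (gfun φ t x) - μ) / (V (gfun φ t x) - x) * φ x +
    (μ - x) / (V (gfun φ t x) - x) * φ (V (gfun φ t x))
  have hC : ContinuousOn C (Set.Iio μ) := by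
    have h1 : ContinuousOn (fun x => V (gfun φ t x)) (Set.Iio μ) := fun x hx =>
      (hVc.continuousAt.comp (gfun_cont H t (ne_of_lt hx))).continuousWithinAt
    have h2 : ContinuousOn φ (Set.Iio μ) := (dok_cont H).continuousOn
    have h3 : ContinuousOn (fun x => φ (V (gfun φ t x))) (Set.Iio μ) :=
      (dok_cont H).comp_continuousOn h1
    have h4 : ∀ x ∈ Set.Iio μ, V (gfun φ t x) - x ≠ 0 := fun x hx => by
      have := (hW x hx).1
      have : x < μ := hx
      exact ne_of_gt (by linarith)
    exact (((h1.sub continuousOn_const).div (h1.sub continuousOn_id) h4).mul h2).add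
      (((continuousOn_const.sub continuousOn_id).div (h1.sub continuousOn_id) h4).mul h3)
  -- small
  have hsmall : ∃ x, x < μ ∧ C x ≤ s := by
    set B := V (gfun φ t (μ - 1)) with hB
    have hBt : t < B := (hW (μ - 1) (by linarith)).1
    set M := φ B / (B - μ) with hM
    have hM0 : 0 ≤ M := div_nonneg (hφ0 _) (by linarith)
    set q := min (1/2) (s / (φ (μ - 1) + M + 1)) with hq
    have hden : 0 < φ (μ - 1) + M + 1 := by linarith [hφ0 (μ - 1)]
    have hq0 : 0 < q := lt_min (by norm_num) (by positivity)
    have hq1 : q ≤ 1/2 := min_le_left _ _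
    have hq2 : q * (φ (μ - 1) + M + 1) ≤ s := by
      rw [← le_div_iff₀ hden]; exact min_le_right _ _
    refine ⟨μ - q, by linarith, ?_⟩
    obtain ⟨hy, -⟩ := hW (μ - q) (by linarith)
    have hyB : V (gfun φ t (μ - q)) < B :=
      hVm (gfun_anti H t (by intro h; linarith) (by intro h; linarith) (by linarith)
        (by linarith))
    simp only [C]
    set y := V (gfun φ t (μ - q)) with hydef
    have e1 : φ (μ - q) ≤ q * φ (μ - 1) := by
      have := H.strict_convex.convexOn.2 (Set.mem_univ (μ - 1)) (Set.mem_univ μ) hq0.le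
        (show 0 ≤ 1 - q by linarith) (by ring)
      simp only [smul_eq_mul, H.zero, mul_zero, add_zero] at this
      have h2 : q * (μ - 1) + (1 - q) * μ = μ - q := by ring
      rwa [h2] at this
    have e2 : φ y ≤ (y - μ) * M := by
      have hBp : 0 < B - μ := by linarith
      have := H.strict_convex.convexOn.2 (Set.mem_univ B) (Set.mem_univ μ)
        (show 0 ≤ (y - μ) / (B - μ) from div_nonneg (by linarith) hBp.le)
        (show 0 ≤ 1 - (y - μ) / (B - μ) by
          rw [sub_nonneg, div_le_one hBp]; linarith) (by ring)
      simp only [smul_eq_mul, H.zero, mul_zero, add_zero] at this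
      have h2 : (y - μ) / (B - μ) * B + (1 - (y - μ) / (B - μ)) * μ = y := by
        field_simp; ring
      rw [h2] at this
      have h3 : (y - μ) / (B - μ) * φ B = (y - μ) * M := by
        rw [hM, div_mul_eq_mul_div, mul_div_assoc]
      linarith
    have hd : 0 < y - (μ - q) := by linarith
    rw [div_mul_eq_mul_div, div_mul_eq_mul_div, ← add_div, div_le_iff₀ hd]
    have hyμ : 0 < y - μ := by linarith
    have f1 : (y - μ) * φ (μ - q) ≤ (y - μ) * (q * φ (μ - 1)) :=
      mul_le_mul_of_nonneg_left e1 hyμ.le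
    have f2 : (μ - (μ - q)) * φ y ≤ q * ((y - μ) * M) := by
      have := mul_le_mul_of_nonneg_left e2 hq0.le
      linarith
    have f3 : (y - μ) * (q * (φ (μ - 1) + M + 1)) ≤ (y - μ) * s :=
      mul_le_mul_of_nonneg_left hq2 hyμ.le
    have f4 : 0 < (y - μ) * q := by positivity
    have f5 : 0 < s * q := by positivity
    nlinarith
  have hlarge : ∃ x, x < μ ∧ s ≤ C x := by
    obtain ⟨b, hb, hb'⟩ := dok_growth_right H s (max (t + 1) (μ + 1)) hs.le
    obtain ⟨a, ha, ha'⟩ := dok_growth_left H s (μ - 1) hs.le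
    simp only [max_le_iff] at hb
    obtain ⟨x, hx, hxg⟩ := gfun_large_left H t (gfun φ t b) a
    have hy : b < V (gfun φ t x) := by
      have := hVm hxg
      rwa [hV' b (by linarith)] at this
    refine ⟨x, by linarith, ?_⟩
    simp only [C]
    set y := V (gfun φ t x) with hydef
    have e1 := ha' x hx
    have e2 := hb' y hy.le
    have hd : 0 < y - x := by linarith
    rw [div_mul_eq_mul_div, div_mul_eq_mul_div, ← add_div, le_div_iff₀ hd]
    have p1 : 1 ≤ y - μ := by linarith
    have p2 : 1 ≤ μ - x := by linarith
    have f1 := mul_le_mul_of_nonneg_left e1 (show 0 ≤ y - μ by linarith)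
    have f2 := mul_le_mul_of_nonneg_left e2 (show 0 ≤ μ - x by linarith)
    have f3 : y - x ≤ 2 * ((y - μ) * (μ - x)) := by nlinarith
    have f4 := mul_le_mul_of_nonneg_left f3 hs.le
    linarith
  obtain ⟨x0, hx0, h0⟩ := hsmall
  obtain ⟨x1, hx1, h1⟩ := hlarge
  obtain ⟨x, hx, hxs⟩ := isPreconnected_Iio.intermediate_value hx0 hx1 hC ⟨h0, h1⟩
  exact ⟨x, V (gfun φ t x), hx, by linarith [(hW x hx).1], (hW x hx).2.symm, hxs⟩

lemma exists_pair {μ s : ℝ} (t : ℝ) {φ : ℝ → ℝ} (hs : 0 < s) (H : DispersionOK μ φ) :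
    ∃ v1 v2 : ℝ, v1 < μ ∧ μ < v2 ∧ gfun φ t v1 = gfun φ t v2 ∧
      ((v2 - μ) / (v2 - v1) * φ v1 + (μ - v1) / (v2 - v1) * φ v2 = s) := by
  rcases le_total μ t with ht | ht
  · exact exists_right hs H ht
  · obtain ⟨u1, u2, h1, h2, h3, h4⟩ := exists_right (t := -t) hs (dok_refl H) (by linarith)
    refine ⟨-u2, -u1, by linarith, by linarith, ?_, ?_⟩
    · rw [gfun_refl, gfun_refl] at h3; exact h3.symm
    · rw [← h4, add_comm]
      congr 2 <;> congr 1 <;> ring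

lemma major {μ t : ℝ} {φ : ℝ → ℝ} (H : DispersionOK μ φ) {v1 v2 : ℝ} (h1 : v1 < μ)
    (h2 : μ < v2) (hg : gfun φ t v1 = gfun φ t v2) :
    ∃ c a b : ℝ, (∀ x, max (x - t) 0 ≤ c * φ x + (a * x + b)) ∧
      (∀ x, max (x - t) 0 = c * φ x + (a * x + b) ↔ x = v1 ∨ x = v2) := by
  have hk := dok_deriv_lt H h1.ne h2.ne' (h1.trans h2)
  unfold gfun at hg
  set d1 := deriv φ v1 with hd1
  set d2 := deriv φ v2 with hd2
  set k := d2 - d1 with hkd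
  have hk0 : 0 < k := by linarith
  have T1 : ∀ x, x ≠ v1 → φ v1 + d1 * (x - v1) < φ x := fun x hx => dok_tangent H h1.ne hx
  have T2 : ∀ x, x ≠ v2 → φ v2 + d2 * (x - v2) < φ x := fun x hx => dok_tangent H h2.ne' hx
  have L : ∀ x, φ v2 + d2 * (x - v2) = φ v1 + d1 * (x - v1) + k * (x - t) := by
    intro x; rw [hkd]; linarith
  have hform : ∀ x, 1 / k * φ x + (-d1 / k * x + (d1 * v1 - φ v1) / k)
      = (φ x - (φ v1 + d1 * (x - v1))) / k := by
    intro x; field_simp; ring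
  have hstrict : ∀ x, x ≠ v1 → x ≠ v2 →
      max (x - t) 0 < (φ x - (φ v1 + d1 * (x - v1))) / k := by
    intro x hx1 hx2
    rw [lt_div_iff₀ hk0]
    have := T1 x hx1
    have := T2 x hx2
    have := L x
    rcases max_cases (x - t) 0 with ⟨h, _⟩ | ⟨h, _⟩ <;> rw [h] <;> nlinarith
  have ht1 : v1 < t := by
    have a1 := T2 v1 (by intro h; linarith)
    have a2 := L v1
    have : k * (v1 - t) < 0 := by linarith
    nlinarith
  have ht2 : t < v2 := by
    have a1 := T1 v2 (by intro h; linarith)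
    have a2 := L v2
    have : 0 < k * (v2 - t) := by linarith
    nlinarith
  have he1 : max (v1 - t) 0 = (φ v1 - (φ v1 + d1 * (v1 - v1))) / k := by
    rw [max_eq_right (by linarith)]; simp
  have he2 : max (v2 - t) 0 = (φ v2 - (φ v1 + d1 * (v2 - v1))) / k := by
    rw [max_eq_left (by linarith), eq_div_iff hk0.ne']
    have := L v2
    linarith
  refine ⟨1 / k, -d1 / k, (d1 * v1 - φ v1) / k, fun x => ?_, fun x => ?_⟩
  · rw [hform]
    by_cases hx1 : x = v1
    · rw [hx1]; exact he1.le
    by_cases hx2 : x = v2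
    · rw [hx2]; exact he2.le
    exact (hstrict x hx1 hx2).le
  · rw [hform]
    constructor
    · intro h
      by_contra hcon
      push Not at hcon
      exact absurd h (hstrict x hcon.1 hcon.2).ne
    · rintro (h | h)
      · rw [h]; exact he1
      · rw [h]; exact he2

lemma integrable_two (f : ℝ → ℝ) (v1 w1 v2 w2 : ℝ) : Integrable f (twoPoint v1 w1 v2 w2) := by
  unfold twoPoint
  refine Integrable.add_measure ?_ ?_
  · exact (integrable_dirac (by simp)).smul_measure (by simp)
  · exact (integrable_dirac (by simp)).smul_measure (by simp)

lemma integral_two (f : ℝ → ℝ) (v1 w1 v2 w2 : ℝ) (h1 : 0 ≤ w1) (h2 : 0 ≤ w2) :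
    ∫ x, f x ∂(twoPoint v1 w1 v2 w2) = w1 * f v1 + w2 * f v2 := by
  unfold twoPoint
  rw [integral_add_measure, integral_smul_measure, integral_smul_measure, integral_dirac,
    integral_dirac, ENNReal.toReal_ofReal h1, ENNReal.toReal_ofReal h2]
  · simp
  · exact (integrable_dirac (by simp)).smul_measure (by simp)
  · exact (integrable_dirac (by simp)).smul_measure (by simp)

lemma two_weights {μ v1 v2 : ℝ} (h1 : v1 < μ) (h2 : μ < v2) :
    0 < (μ - v1) / (v2 - v1) ∧ 0 < 1 - (μ - v1) / (v2 - v1) ∧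
    1 - (μ - v1) / (v2 - v1) = (v2 - μ) / (v2 - v1) := by
  have hd : 0 < v2 - v1 := by linarith
  have e : 1 - (μ - v1) / (v2 - v1) = (v2 - μ) / (v2 - v1) := by
    field_simp; ring
  refine ⟨div_pos (by linarith) hd, ?_, e⟩
  rw [e]; exact div_pos (by linarith) hd

lemma two_mem {μ s v1 v2 : ℝ} {φ : ℝ → ℝ} (h1 : v1 < μ) (h2 : μ < v2)
    (hc : (v2 - μ) / (v2 - v1) * φ v1 + (μ - v1) / (v2 - v1) * φ v2 = s) :
    memAmb μ s φ
        (twoPoint v1 (1 - (μ - v1) / (v2 - v1)) v2 ((μ - v1) / (v2 - v1))) := by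
  obtain ⟨p2, p1, e⟩ := two_weights h1 h2
  refine ⟨⟨?_⟩, integrable_two _ _ _ _ _, ?_, integrable_two _ _ _ _ _, ?_⟩
  · unfold twoPoint
    simp only [Measure.add_apply, Measure.smul_apply, measure_univ, smul_eq_mul, mul_one]
    rw [← ENNReal.ofReal_add p1.le p2.le]
    simp
  · rw [integral_two _ _ _ _ _ p1.le p2.le]
    have hd : v2 - v1 ≠ 0 := by intro h; linarith
    field_simp; ring
  · rw [integral_two _ _ _ _ _ p1.le p2.le, e, hc]

lemma integral_major {μ s : ℝ} {φ : ℝ → ℝ} {P : Measure ℝ} (hP : memAmb μ s φ P) (c a b : ℝ) :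
    Integrable (fun x => c * φ x + (a * x + b)) P ∧
    ∫ x, (c * φ x + (a * x + b)) ∂P = c * s + (a * μ + b) := by
  obtain ⟨hp, i1, e1, i2, e2⟩ := hP
  have j1 : Integrable (fun x => c * φ x) P := i2.const_mul c
  have j2 : Integrable (fun x : ℝ => a * x) P := i1.const_mul a
  have j3 : Integrable (fun x : ℝ => a * x + b) P := j2.add (integrable_const b)
  refine ⟨j1.add j3, ?_⟩
  rw [integral_add j1 j3, integral_add j2 (integrable_const b), integral_const_mul,
    integral_const_mul, e1, e2]
  simp

lemma two_opt {μ s t v1 v2 c a b : ℝ} {φ : ℝ → ℝ} (h1 : v1 < μ) (h2 : μ < v2)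
    (hc : (v2 - μ) / (v2 - v1) * φ v1 + (μ - v1) / (v2 - v1) * φ v2 = s)
    (e1 : max (v1 - t) 0 = c * φ v1 + (a * v1 + b))
    (e2 : max (v2 - t) 0 = c * φ v2 + (a * v2 + b)) :
    ∫ x, max (x - t) 0
      ∂(twoPoint v1 (1 - (μ - v1) / (v2 - v1)) v2 ((μ - v1) / (v2 - v1)))
      = c * s + (a * μ + b) := by
  obtain ⟨p2, p1, e⟩ := two_weights h1 h2
  rw [← (integral_major (two_mem h1 h2 hc) c a b).2, integral_two _ _ _ _ _ p1.le p2.le,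
    integral_two _ _ _ _ _ p1.le p2.le, e1, e2]

lemma memAmb_le {μ s t c a b : ℝ} {φ : ℝ → ℝ}
    (hm : ∀ x, max (x - t) 0 ≤ c * φ x + (a * x + b)) {P : Measure ℝ} (hP : memAmb μ s φ P) :
    ∫ x, max (x - t) 0 ∂P ≤ c * s + (a * μ + b) := by
  rw [← (integral_major hP c a b).2]
  have := hP.1
  refine integral_mono ?_ (integral_major hP c a b).1 hm
  exact (hP.2.1.sub (integrable_const t)).pos_part

lemma uniq {μ s t : ℝ} {φ : ℝ → ℝ} (H : DispersionOK μ φ) {v1 v2 u1 u2 : ℝ} (h1 : v1 < μ)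
    (h2 : μ < v2) (hg : gfun φ t v1 = gfun φ t v2)
    (hc : (v2 - μ) / (v2 - v1) * φ v1 + (μ - v1) / (v2 - v1) * φ v2 = s)
    (k1 : u1 < μ) (k2 : μ < u2) (kg : gfun φ t u1 = gfun φ t u2)
    (kc : (u2 - μ) / (u2 - u1) * φ u1 + (μ - u1) / (u2 - u1) * φ u2 = s) :
    u1 = v1 ∧ u2 = v2 := by
  obtain ⟨c, a, b, hm, he⟩ := major H h1 h2 hg
  obtain ⟨c', a', b', hm', he'⟩ := major H k1 k2 kg
  have A := two_opt (t := t) h1 h2 hc ((he v1).2 (Or.inl rfl)) ((he v2).2 (Or.inr rfl))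
  have A' := two_opt (t := t) k1 k2 kc ((he' u1).2 (Or.inl rfl)) ((he' u2).2 (Or.inr rfl))
  have B' := memAmb_le hm' (two_mem h1 h2 hc)
  obtain ⟨p2, p1, e⟩ := two_weights k1 k2
  have D := (integral_major (two_mem k1 k2 kc) c a b).2
  rw [integral_two _ _ _ _ _ p1.le p2.le] at D A'
  set w := (μ - u1) / (u2 - u1)
  have m1 := hm u1
  have m2 := hm u2
  have g1 := mul_le_mul_of_nonneg_left m1 p1.le
  have g2 := mul_le_mul_of_nonneg_left m2 p2.le
  have q1 : max (u1 - t) 0 = c * φ u1 + (a * u1 + b) :=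
    le_antisymm m1 (le_of_mul_le_mul_left (by linarith) p1)
  have q2 : max (u2 - t) 0 = c * φ u2 + (a * u2 + b) :=
    le_antisymm m2 (le_of_mul_le_mul_left (by linarith) p2)
  constructor
  · rcases (he u1).1 q1 with h | h
    · exact h
    · linarith
  · rcases (he u2).1 q2 with h | h
    · linarith
    · exact h

/-- The worst case of the max-operator `E_P[max{X - t, 0}]` over
`P(μ,s,φ)` is the unique two-point distribution solving the first-order system. -/
theorem stmt15 (μ s t : ℝ) (φ : ℝ → ℝ) (hs : 0 < s) (hφ : DispersionOK μ φ) :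
    ∃ v1 v2 : ℝ, v1 < μ ∧ μ < v2 ∧
      ((v1 - t) * deriv φ v1 - φ v1 = (v2 - t) * deriv φ v2 - φ v2) ∧
      ((v2 - μ) / (v2 - v1) * φ v1 + (μ - v1) / (v2 - v1) * φ v2 = s) ∧
      (∀ u1 u2 : ℝ, u1 < μ → μ < u2 →
        (u1 - t) * deriv φ u1 - φ u1 = (u2 - t) * deriv φ u2 - φ u2 →
        (u2 - μ) / (u2 - u1) * φ u1 + (μ - u1) / (u2 - u1) * φ u2 = s →
        u1 = v1 ∧ u2 = v2) ∧
      memAmb μ s φ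
        (twoPoint v1 (1 - (μ - v1) / (v2 - v1)) v2 ((μ - v1) / (v2 - v1))) ∧
      (∀ P : Measure ℝ, memAmb μ s φ P →
        (∫ x, max (x - t) 0 ∂P) ≤
          ∫ x, max (x - t) 0
            ∂(twoPoint v1 (1 - (μ - v1) / (v2 - v1)) v2 ((μ - v1) / (v2 - v1)))) := by
  obtain ⟨v1, v2, h1, h2, hg, hc⟩ := exists_pair t hs hφ
  refine ⟨v1, v2, h1, h2, hg, hc, fun u1 u2 k1 k2 kg kc => uniq hφ h1 h2 hg hc k1 k2 kg kc,
    two_mem h1 h2 hc, fun P hP => ?_⟩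
  obtain ⟨c, a, b, hm, he⟩ := major hφ h1 h2 hg
  rw [two_opt (t := t) h1 h2 hc ((he v1).2 (Or.inl rfl)) ((he v2).2 (Or.inr rfl))]
  exact memAmb_le hm hP
end

section
/- Let μ ∈ ℝ, d > 0 and t ∈ ℝ. Then the supremum over P ∈ P(μ,d) of E_P[max{X − t, 0}] equals max{μ − t, 0} + d/2; in particular it equals μ − t + d/2 when t < μ and d/2 when t ≥ μ. Moreover, when t = μ every P ∈ P(μ,d) satisfies E_P[max{X − μ, 0}] = d/2 exactly. -/
open MeasureTheory

lemma aux_exact (μ d : ℝ) (P : Measure ℝ) (h : memMAD μ d P) :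
    Integrable (fun x : ℝ => max (x - μ) 0) P ∧ (∫ x, max (x - μ) 0 ∂P) = d / 2 := by
  obtain ⟨hP, h1, h2, h3, h4⟩ := h
  have e : (fun x : ℝ => max (x - μ) 0) = fun x => (1 / 2 : ℝ) * ((x - μ) + |x - μ|) := by
    funext x
    rcases le_total (x - μ) 0 with h | h
    · rw [max_eq_right h, abs_of_nonpos h]; ring
    · rw [max_eq_left h, abs_of_nonneg h]; ring
  have h5 : Integrable (fun x : ℝ => x - μ) P := h1.sub (integrable_const μ)
  rw [e]
  refine ⟨(h5.add h3).const_mul _, ?_⟩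
  rw [integral_const_mul, integral_add h5 h3, integral_sub h1 (integrable_const μ), h2, h4]
  simp
  ring

noncomputable def threePt (μ a p : ℝ) : Measure ℝ :=
  ENNReal.ofReal p • Measure.dirac (μ + a) + ENNReal.ofReal p • Measure.dirac (μ - a)
    + ENNReal.ofReal (1 - 2 * p) • Measure.dirac μ

lemma threePt_int (μ a p : ℝ) (f : ℝ → ℝ) : Integrable f (threePt μ a p) := by
  have h : ∀ (x q : ℝ), Integrable f (ENNReal.ofReal q • Measure.dirac x) := fun x q =>
    (integrable_dirac (by simp)).smul_measure ENNReal.ofReal_ne_top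
  exact ((h _ _).add_measure (h _ _)).add_measure (h _ _)

lemma threePt_integral (μ a p : ℝ) (hp : 0 ≤ p) (hp1 : 2 * p ≤ 1) (f : ℝ → ℝ) :
    ∫ x, f x ∂(threePt μ a p) = p * f (μ + a) + p * f (μ - a) + (1 - 2 * p) * f μ := by
  have h : ∀ (x q : ℝ), Integrable f (ENNReal.ofReal q • Measure.dirac x) := fun x q =>
    (integrable_dirac (by simp)).smul_measure ENNReal.ofReal_ne_top
  unfold threePt
  rw [integral_add_measure ((h _ _).add_measure (h _ _)) (h _ _),
    integral_add_measure (h _ _) (h _ _)]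
  simp only [integral_smul_measure, integral_dirac, smul_eq_mul]
  rw [ENNReal.toReal_ofReal hp, ENNReal.toReal_ofReal (by linarith)]

lemma threePt_prob (μ a p : ℝ) (hp : 0 ≤ p) (hp1 : 2 * p ≤ 1) :
    IsProbabilityMeasure (threePt μ a p) := by
  constructor
  simp only [threePt, Measure.add_apply, Measure.smul_apply, measure_univ, smul_eq_mul, mul_one]
  rw [← ENNReal.ofReal_add hp hp, ← ENNReal.ofReal_add (by linarith) (by linarith)]
  ring_nf
  simp

lemma threePt_mem (μ d a : ℝ) (hd : 0 < d) (ha : d ≤ a) :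
    memMAD μ d (threePt μ a (d / (2 * a))) := by
  have ha0 : 0 < a := by linarith
  have hp : 0 ≤ d / (2 * a) := by positivity
  have hp1 : 2 * (d / (2 * a)) ≤ 1 := by
    have : 2 * (d / (2 * a)) = d / a := by field_simp
    rw [this]; exact (div_le_one ha0).2 ha
  refine ⟨threePt_prob _ _ _ hp hp1, threePt_int _ _ _ _, ?_, threePt_int _ _ _ _, ?_⟩
  · rw [threePt_integral _ _ _ hp hp1]; ring
  · rw [threePt_integral _ _ _ hp hp1]
    have e1 : |μ + a - μ| = a := by rw [add_sub_cancel_left, abs_of_pos ha0]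
    have e2 : |μ - a - μ| = a := by
      rw [show μ - a - μ = -a by ring, abs_neg, abs_of_pos ha0]
    rw [e1, e2, sub_self, abs_zero]
    field_simp
    ring

lemma aux_sup (μ d t : ℝ) (hd : 0 < d) :
    sSup {y : ℝ | ∃ P : Measure ℝ, memMAD μ d P ∧ y = ∫ x, max (x - t) 0 ∂P} =
      max (μ - t) 0 + d / 2 := by
  apply csSup_eq_of_forall_le_of_forall_lt_exists_gt
  · exact ⟨_, _, threePt_mem μ d d hd le_rfl, rfl⟩
  · rintro y ⟨P, hP, rfl⟩
    obtain ⟨hi, he⟩ := aux_exact μ d P hP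
    have := hP.1
    have hc : Integrable (fun _ : ℝ => max (μ - t) 0) P := integrable_const _
    calc ∫ x, max (x - t) 0 ∂P ≤ ∫ x, (max (μ - t) 0 + max (x - μ) 0) ∂P := by
          apply integral_mono_of_nonneg (Filter.Eventually.of_forall fun x => le_max_right _ _)
            (hc.add hi)
          refine Filter.Eventually.of_forall fun x => ?_
          have h1 := le_max_left (μ - t) 0
          have h2 := le_max_right (μ - t) 0
          have h3 := le_max_left (x - μ) 0
          have h4 := le_max_right (x - μ) 0
          show max (x - t) 0 ≤ max (μ - t) 0 + max (x - μ) 0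
          exact max_le (by linarith) (by linarith)
      _ = _ := by rw [integral_add hc hi, he]; simp
  · intro w hw
    set ε := max (μ - t) 0 + d / 2 - w with hε
    have hε0 : 0 < ε := by linarith
    set s := μ - t with hs
    set a := d + |s| + d * |s| / ε with ha
    have hs0 := abs_nonneg s
    have hq : 0 ≤ d * |s| / ε := by positivity
    have had : d ≤ a := by linarith
    have ha0 : 0 < a := by linarith
    have hsa : |s| ≤ a := by linarith
    refine ⟨_, ⟨_, threePt_mem μ d a hd had, rfl⟩, ?_⟩
    have hp : 0 ≤ d / (2 * a) := by positivity
    have hp1 : 2 * (d / (2 * a)) ≤ 1 := by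
      have : 2 * (d / (2 * a)) = d / a := by field_simp
      rw [this]; exact (div_le_one ha0).2 had
    have hpa : d / (2 * a) * a = d / 2 := by field_simp
    rw [threePt_integral _ _ _ hp hp1]
    have hps : d / (2 * a) * |s| < ε := by
      rw [div_mul_eq_mul_div, div_lt_iff₀ (by positivity)]
      have : ε * a = ε * d + ε * |s| + d * |s| := by rw [ha]; field_simp
      nlinarith [mul_pos hε0 hd, mul_nonneg hε0.le hs0, mul_nonneg hd.le hs0]
    obtain ⟨h1, h2⟩ := abs_le.1 hsa
    rw [show μ + a - t = s + a by rw [hs]; ring, show μ - a - t = s - a by rw [hs]; ring,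
      max_eq_left (show 0 ≤ s + a by linarith), max_eq_right (show s - a ≤ 0 by linarith), ← hs]
    generalize d / (2 * a) = p at *
    rcases le_total s 0 with h | h
    · rw [max_eq_right h] at *
      rw [abs_of_nonpos h] at hps
      nlinarith
    · rw [max_eq_left h] at *
      rw [abs_of_nonneg h] at hps
      nlinarith

/-- The tight upper bound of the max-operator over the mean-MAD
ambiguity set equals `max{μ - t, 0} + d/2`, and for `t = μ` every distribution in
the ambiguity set attains the value `d/2` exactly. -/
theorem stmt17 (μ d t : ℝ) (hd : 0 < d) :
    sSup {y : ℝ | ∃ P : Measure ℝ, memMAD μ d P ∧ y = ∫ x, max (x - t) 0 ∂P} =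
      max (μ - t) 0 + d / 2 ∧
    (t < μ →
      sSup {y : ℝ | ∃ P : Measure ℝ, memMAD μ d P ∧ y = ∫ x, max (x - t) 0 ∂P} =
        μ - t + d / 2) ∧
    (μ ≤ t →
      sSup {y : ℝ | ∃ P : Measure ℝ, memMAD μ d P ∧ y = ∫ x, max (x - t) 0 ∂P} =
        d / 2) ∧
    (∀ P : Measure ℝ, memMAD μ d P → (∫ x, max (x - μ) 0 ∂P) = d / 2) := by
  refine ⟨aux_sup μ d t hd, fun h => ?_, fun h => ?_, fun P hP => (aux_exact μ d P hP).2⟩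
  · rw [aux_sup μ d t hd, max_eq_left (by linarith)]
  · rw [aux_sup μ d t hd, max_eq_right (by linarith), zero_add]
end

section
/- Let μ ∈ ℝ, s > 0, let φ satisfy the assumption on the dispersion function, and let 0 < r < μ. Then every P ∈ P(μ,s,φ) satisfies P(X ≥ r) > 0, OPT(P) is finite, and the supremum over P ∈ P(μ,s,φ) of OPT(P)/REV(r,P) equals the maximum of the two quantities 1 / (inf over P ∈ P(μ,s,φ) of P([r,∞))) and (1/r) · (sup over P ∈ P(μ,s,φ) of E_P(X | X ≥ r)). -/
open MeasureTheory Filter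

/-- The revenue at price `r` under demand distribution `P`. -/
noncomputable def REV (r : ℝ) (P : Measure ℝ) : ℝ := r * (P (Set.Ici r)).toReal

/-- The optimal revenue for demand distribution `P`. -/
noncomputable def OPT (P : Measure ℝ) : ℝ :=
  sSup ((fun x => x * (P (Set.Ici x)).toReal) '' Set.Ioi (0 : ℝ))

lemma DispersionOK.cont {μ : ℝ} {φ : ℝ → ℝ} (h : DispersionOK μ φ) : Continuous φ :=
  continuousOn_univ.1 (h.strict_convex.convexOn.continuousOn isOpen_univ)

lemma DispersionOK.nonneg {μ : ℝ} {φ : ℝ → ℝ} (h : DispersionOK μ φ) (x : ℝ) : 0 ≤ φ x :=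
  h.zero ▸ h.isMin x

lemma DispersionOK.bound {μ : ℝ} {φ : ℝ → ℝ} (h : DispersionOK μ φ) (K : ℝ) (hK : 0 < K) :
    ∃ M : ℝ, 0 < M ∧ ∀ x, |x| ≤ M + φ x / K := by
  have h1 := h.growth.eventually_ge_atTop K
  rw [← Metric.cobounded_eq_cocompact, ← comap_norm_atTop, eventually_comap] at h1
  obtain ⟨M, hM⟩ := eventually_atTop.1 h1
  refine ⟨max M 1, by positivity, fun x => ?_⟩
  have h0 : 0 ≤ φ x / K := div_nonneg (h.nonneg x) hK.le
  by_cases hx : |x| ≤ max M 1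
  · linarith
  · push Not at hx
    have h2 := hM |x| ((le_max_left _ _).trans hx.le) x rfl
    have hx0 : 0 < |x| := lt_of_lt_of_le (by positivity) hx.le
    rw [abs_div, abs_of_nonneg (h.nonneg x), le_div_iff₀ hx0] at h2
    have : |x| ≤ φ x / K := by rw [le_div_iff₀ hK]; linarith
    have : (0:ℝ) < max M 1 := by positivity
    linarith

lemma DispersionOK.mono {μ : ℝ} {φ : ℝ → ℝ} (h : DispersionOK μ φ) {x y : ℝ}
    (h1 : μ ≤ x) (h2 : x ≤ y) : φ x ≤ φ y := by
  rcases h1.eq_or_lt with rfl | h1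
  · exact h.isMin y
  have := h.strict_convex.convexOn.le_max_of_mem_Icc (Set.mem_univ μ) (Set.mem_univ y) ⟨h1.le, h2⟩
  rwa [max_eq_right (h.isMin y)] at this

lemma DispersionOK.anti {μ : ℝ} {φ : ℝ → ℝ} (h : DispersionOK μ φ) {x y : ℝ}
    (h1 : x ≤ y) (h2 : y ≤ μ) : φ y ≤ φ x := by
  have := h.strict_convex.convexOn.le_max_of_mem_Icc (Set.mem_univ x) (Set.mem_univ μ) ⟨h1, h2⟩
  rwa [max_eq_left (h.isMin x)] at this

/-- pushing the upper point outwards until the dispersion equals `s` -/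
lemma exists_upper {μ s : ℝ} {φ : ℝ → ℝ} (hs : 0 < s) (h : DispersionOK μ φ) {x₁ y : ℝ}
    (h1 : x₁ < μ)
    (hle : (μ - x₁) * φ y + (y - μ) * φ x₁ ≤ s * (y - x₁)) :
    ∃ x₂, y ≤ x₂ ∧ (μ - x₁) * φ x₂ + (x₂ - μ) * φ x₁ = s * (x₂ - x₁) := by
  have hd : 0 < μ - x₁ := sub_pos.2 h1
  obtain ⟨M, hM, hb⟩ := h.bound (2 * s / (μ - x₁)) (by positivity)
  set b := max y (max μ (2 * M - x₁)) with hbdef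
  have hyb : y ≤ b := le_max_left _ _
  have hμb : μ ≤ b := (le_max_left _ _).trans (le_max_right _ _)
  have hMb : 2 * M - x₁ ≤ b := (le_max_right _ _).trans (le_max_right _ _)
  let g : ℝ → ℝ := fun x => (μ - x₁) * φ x + (x - μ) * φ x₁ - s * (x - x₁)
  have hg : Continuous g := by
    have := h.cont
    fun_prop
  have hgy : g y ≤ 0 := by simp only [g]; linarith
  have hgb : 0 ≤ g b := by
    have h3 := (le_abs_self b).trans (hb b)
    have h4 : φ b / (2 * s / (μ - x₁)) = (μ - x₁) * φ b / (2 * s) := by field_simp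
    rw [h4] at h3
    have h5 : 2 * s * (b - M) ≤ (μ - x₁) * φ b := by
      have : b - M ≤ (μ - x₁) * φ b / (2 * s) := by linarith
      rw [le_div_iff₀ (by positivity)] at this
      linarith
    have h6 : 0 ≤ (b - μ) * φ x₁ := mul_nonneg (by linarith) (h.nonneg _)
    simp only [g]
    nlinarith
  obtain ⟨x₂, hx, hx0⟩ := intermediate_value_Icc hyb hg.continuousOn ⟨hgy, hgb⟩
  exact ⟨x₂, hx.1, by simp only [g] at hx0; linarith⟩

lemma exists_two_point {μ s : ℝ} {φ : ℝ → ℝ} {x₁ x₂ : ℝ}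
    (h1 : x₁ < μ) (h2 : μ ≤ x₂)
    (he : (μ - x₁) * φ x₂ + (x₂ - μ) * φ x₁ = s * (x₂ - x₁)) :
    ∃ Q : Measure ℝ, memAmb μ s φ Q ∧
      (∀ t, x₁ < t → t ≤ x₂ → (Q (Set.Ici t)).toReal = (μ - x₁) / (x₂ - x₁)) ∧
      (Q (Set.Ici x₁)).toReal = 1 := by
  have hd : 0 < x₂ - x₁ := by linarith
  set q := (μ - x₁) / (x₂ - x₁) with hq
  have hq0 : 0 ≤ q := div_nonneg (by linarith) hd.le
  have hq1 : 0 ≤ 1 - q := by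
    have : q ≤ 1 := by rw [hq, div_le_one hd]; linarith
    linarith
  let Q : Measure ℝ := ENNReal.ofReal (1 - q) • Measure.dirac x₁ + ENNReal.ofReal q • Measure.dirac x₂
  have hint : ∀ f : ℝ → ℝ, Integrable f Q := fun f => by
    refine Integrable.add_measure ?_ ?_ <;>
    exact (integrable_dirac (by simp)).smul_measure (by simp)
  have hval : ∀ f : ℝ → ℝ, ∫ x, f x ∂Q = (1 - q) * f x₁ + q * f x₂ := fun f => by
    rw [integral_add_measure, integral_smul_measure, integral_smul_measure, integral_dirac,
      integral_dirac, ENNReal.toReal_ofReal hq0, ENNReal.toReal_ofReal hq1]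
    · simp
    · exact (integrable_dirac (by simp)).smul_measure (by simp)
    · exact (integrable_dirac (by simp)).smul_measure (by simp)
  have hsum : ENNReal.ofReal (1 - q) + ENNReal.ofReal q = 1 := by
    rw [← ENNReal.ofReal_add hq1 hq0]; simp
  refine ⟨Q, ⟨⟨by simp [Q, hsum]⟩, hint _, ?_, hint _, ?_⟩, ?_, ?_⟩
  · rw [hval, hq]; field_simp; ring
  · rw [hval, hq]
    have : (1 - (μ - x₁) / (x₂ - x₁)) * φ x₁ + (μ - x₁) / (x₂ - x₁) * φ x₂
      = ((μ - x₁) * φ x₂ + (x₂ - μ) * φ x₁) / (x₂ - x₁) := by field_simp; ring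
    rw [this, he]; field_simp
  · intro t ht1 ht2
    simp [Q, not_le.2 ht1, ht2, hq0, measurableSet_Ici, Set.indicator]
  · have : x₁ ≤ x₂ := by linarith
    simp [Q, this, hsum, measurableSet_Ici, Set.indicator]

lemma tail_integral_lower {P : Measure ℝ} [IsProbabilityMeasure P] {t : ℝ}
    (hi : Integrable (fun x : ℝ => x) P) :
    t * (P (Set.Ici t)).toReal ≤ ∫ x in Set.Ici t, x ∂P :=
  setIntegral_ge_of_const_le_real measurableSet_Ici (measure_ne_top _ _) (fun _ hx => hx)
    hi.integrableOn

lemma prob_toReal_le_one {P : Measure ℝ} [IsProbabilityMeasure P] (A : Set ℝ) :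
    (P A).toReal ≤ 1 := measureReal_le_one

lemma rev_bound {P : Measure ℝ} [IsProbabilityMeasure P] {r t : ℝ} (hr : 0 < r) (ht : 0 < t)
    (hi : Integrable (fun x : ℝ => x) P) :
    t * (P (Set.Ici t)).toReal ≤ max r (∫ x in Set.Ici r, x ∂P) := by
  rcases le_total t r with h | h
  · refine le_max_of_le_left ?_
    have := prob_toReal_le_one (P := P) (Set.Ici t)
    nlinarith
  · refine le_max_of_le_right ((tail_integral_lower hi).trans ?_)
    refine setIntegral_mono_set hi.integrableOn ?_ (Set.Ici_subset_Ici.2 h).eventuallyLE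
    filter_upwards [ae_restrict_mem measurableSet_Ici] with x hx
    exact hr.le.trans hx

lemma opt_bdd {P : Measure ℝ} [IsProbabilityMeasure P] {r : ℝ} (hr : 0 < r)
    (hi : Integrable (fun x : ℝ => x) P) :
    BddAbove ((fun x => x * (P (Set.Ici x)).toReal) '' Set.Ioi (0 : ℝ)) := by
  refine ⟨max r (∫ x in Set.Ici r, x ∂P), ?_⟩
  rintro _ ⟨t, ht, rfl⟩
  exact rev_bound hr ht hi

lemma opt_le {P : Measure ℝ} [IsProbabilityMeasure P] {r : ℝ} (hr : 0 < r)
    (hi : Integrable (fun x : ℝ => x) P) : OPT P ≤ max r (∫ x in Set.Ici r, x ∂P) := by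
  refine csSup_le ⟨_, 1, by simp, rfl⟩ ?_
  rintro _ ⟨t, ht, rfl⟩
  exact rev_bound hr ht hi

lemma le_opt {P : Measure ℝ} [IsProbabilityMeasure P] {t : ℝ} (ht : 0 < t)
    (hi : Integrable (fun x : ℝ => x) P) : t * (P (Set.Ici t)).toReal ≤ OPT P :=
  le_csSup (opt_bdd ht hi) ⟨t, ht, rfl⟩

/-- uniform bounds over the ambiguity set -/
lemma amb_bounds {μ s r : ℝ} {φ : ℝ → ℝ} (hs : 0 < s) (h : DispersionOK μ φ) (hr : 0 < r)
    (hrμ : r < μ) : ∃ c C : ℝ, 0 < c ∧ ∀ P, memAmb μ s φ P →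
      c ≤ (P (Set.Ici r)).toReal ∧
      (∫ x in Set.Ici r, x ∂P) ≤ C := by
  have key : ∀ K M : ℝ, 0 < K → 0 < M → (∀ x, |x| ≤ M + φ x / K) → ∀ P, memAmb μ s φ P →
      (∫ x in Set.Ici r, x ∂P) ≤ M * (P (Set.Ici r)).toReal + s / K := by
    intro K M hK hM hb P hP
    obtain ⟨hP, hi, hμ, hφi, hφs⟩ := hP
    calc (∫ x in Set.Ici r, x ∂P) ≤ ∫ x in Set.Ici r, (M + φ x / K) ∂P :=
          setIntegral_mono_on hi.integrableOn
            ((integrable_const M).add (hφi.div_const K)).integrableOn measurableSet_Ici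
            (fun x _ => (le_abs_self x).trans (hb x))
      _ = M * (P (Set.Ici r)).toReal + (∫ x in Set.Ici r, φ x ∂P) / K := by
          rw [integral_add (integrable_const M) (hφi.div_const K).integrableOn, integral_div]
          simp [Measure.real, mul_comm]
      _ ≤ _ := by
          have : (∫ x in Set.Ici r, φ x ∂P) ≤ s := by
            rw [← hφs]
            exact setIntegral_le_integral hφi (Eventually.of_forall h.nonneg)
          gcongr
  have hd : 0 < μ - r := sub_pos.2 hrμ
  obtain ⟨M, hM, hb⟩ := h.bound (2 * s / (μ - r)) (by positivity)
  refine ⟨(μ - r) / (2 * M), M + (μ - r) / 2, by positivity, fun P hP => ?_⟩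
  have h1 := key _ M (by positivity) hM hb P hP
  have e : s / (2 * s / (μ - r)) = (μ - r) / 2 := by field_simp
  rw [e] at h1
  obtain ⟨hPp, hi, hμ, hφi, hφs⟩ := hP
  have hp1 := prob_toReal_le_one (P := P) (Set.Ici r)
  constructor
  · have h2 := integral_add_compl (measurableSet_Ici (a := r)) hi
    have h3 : (∫ x in (Set.Ici r)ᶜ, x ∂P) ≤ ∫ x in (Set.Ici r)ᶜ, r ∂P :=
      setIntegral_mono_on hi.integrableOn (integrable_const r) measurableSet_Ici.compl
        (fun x hx => by simp at hx; exact hx.le)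
    have h4 : (∫ x in (Set.Ici r)ᶜ, r ∂P) ≤ r := by
      rw [setIntegral_const, smul_eq_mul]
      have : P.real (Set.Ici r)ᶜ ≤ 1 := measureReal_le_one
      nlinarith
    rw [div_le_iff₀ (by positivity)]
    linarith
  · nlinarith

/-- collapsing a distribution in the ambiguity set to two points -/
lemma collapse {μ s r : ℝ} {φ : ℝ → ℝ} (hs : 0 < s) (h : DispersionOK μ φ)
    (hrμ : r < μ) {P : Measure ℝ} (hP : memAmb μ s φ P) (hp : 0 < (P (Set.Ici r)).toReal) :
    ∃ m₁ m₂, m₁ < r ∧ m₂ = (∫ x in Set.Ici r, x ∂P) / (P (Set.Ici r)).toReal ∧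
      (1 - (P (Set.Ici r)).toReal) * m₁ + (P (Set.Ici r)).toReal * m₂ = μ ∧
      (1 - (P (Set.Ici r)).toReal) * φ m₁ + (P (Set.Ici r)).toReal * φ m₂ ≤ s := by
  obtain ⟨hPp, hi, hμ, hφi, hφs⟩ := hP
  set p := (P (Set.Ici r)).toReal with hpdef
  have hp1 : p ≤ 1 := prob_toReal_le_one _
  have hc : P.real (Set.Ici r)ᶜ = 1 - p := probReal_compl_eq_one_sub measurableSet_Ici
  have jensen : ∀ A : Set ℝ, 0 < P.real A →
      P.real A * φ ((∫ x in A, x ∂P) / P.real A) ≤ ∫ x in A, φ x ∂P := by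
    intro A hA
    have hA0 : P A ≠ 0 := by
      intro h0
      simp [Measure.real, h0] at hA
    have := h.strict_convex.convexOn.map_set_average_le (μ := P) (t := A) (f := fun x => x)
      h.cont.continuousOn isClosed_univ hA0 (measure_ne_top _ _) (by simp) hi.integrableOn
      hφi.integrableOn
    rw [setAverage_eq, setAverage_eq, smul_eq_mul, smul_eq_mul] at this
    rw [div_eq_inv_mul]
    calc _ ≤ P.real A * ((P.real A)⁻¹ * ∫ x in A, φ x ∂P) := by gcongr
      _ = _ := by field_simp
  have hsx := integral_add_compl (measurableSet_Ici (a := r)) hi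
  have hsφ := integral_add_compl (measurableSet_Ici (a := r)) hφi
  have j2 := jensen (Set.Ici r) hp
  change p * φ ((∫ x in Set.Ici r, x ∂P) / p) ≤ _ at j2
  rcases hp1.eq_or_lt with h1 | h1
  · have hz : P (Set.Ici r)ᶜ = 0 := by
      rw [h1] at hc
      simpa [Measure.real, ENNReal.toReal_eq_zero_iff] using hc
    rw [setIntegral_measure_zero _ hz] at hsx hsφ
    refine ⟨r - 1, _, by linarith, rfl, ?_, ?_⟩
    · rw [h1]; simp; linarith
    · rw [h1] at j2 ⊢; linarith
  · have h1' : 0 < 1 - p := by linarith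
    have j1 := jensen (Set.Ici r)ᶜ (by rw [hc]; exact h1')
    rw [hc] at j1
    refine ⟨(∫ x in (Set.Ici r)ᶜ, x ∂P) / (1 - p), _, ?_, rfl, ?_, ?_⟩
    · rw [div_lt_iff₀ h1']
      have hii : IntegrableOn (fun x => r - x) (Set.Ici r)ᶜ P :=
        ((integrable_const r).sub hi).integrableOn
      have hpos : 0 < ∫ x in (Set.Ici r)ᶜ, (r - x) ∂P := by
        rw [setIntegral_pos_iff_support_of_nonneg_ae _ hii]
        · have : Function.support (fun x => r - x) ∩ (Set.Ici r)ᶜ = (Set.Ici r)ᶜ := by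
            refine Set.inter_eq_right.2 fun x hx => ?_
            have : x < r := not_le.1 hx
            simp only [Function.mem_support]
            linarith
          rw [this, pos_iff_ne_zero]
          intro h0
          rw [Measure.real, h0] at hc
          simp at hc
          linarith
        · filter_upwards [ae_restrict_mem measurableSet_Ici.compl] with x hx
          have : x < r := not_le.1 hx
          simp only [Pi.zero_apply]
          linarith
      rw [integral_sub (integrable_const r) hi.integrableOn, setIntegral_const, hc, smul_eq_mul]
        at hpos
      linarith
    · have e1 : (1 - p) * ((∫ x in (Set.Ici r)ᶜ, x ∂P) / (1 - p)) = ∫ x in (Set.Ici r)ᶜ, x ∂P := by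
        field_simp
      have e2 : p * ((∫ x in (Set.Ici r), x ∂P) / p) = ∫ x in (Set.Ici r), x ∂P := by
        field_simp
      rw [e1, e2]; linarith
    · linarith

/-- The worst-case approximation ratio decomposes into the worst-case
tail probability and the worst-case conditional expectation. -/
theorem stmt18 (μ s r : ℝ) (φ : ℝ → ℝ) (hs : 0 < s) (hφ : DispersionOK μ φ)
    (hr0 : 0 < r) (hrμ : r < μ) :
    (∀ P : Measure ℝ, memAmb μ s φ P →
      0 < (P (Set.Ici r)).toReal ∧
      BddAbove ((fun x => x * (P (Set.Ici x)).toReal) '' Set.Ioi (0 : ℝ))) ∧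
    sSup {y : ℝ | ∃ P : Measure ℝ, memAmb μ s φ P ∧ y = OPT P / REV r P} =
      max (1 / sInf {y : ℝ | ∃ P : Measure ℝ, memAmb μ s φ P ∧
              y = (P (Set.Ici r)).toReal})
          ((1 / r) * sSup {y : ℝ | ∃ P : Measure ℝ, memAmb μ s φ P ∧
              y = (∫ x in Set.Ici r, x ∂P) / (P (Set.Ici r)).toReal}) := by
  obtain ⟨c, C, hc, hcC⟩ := amb_bounds hs hφ hr0 hrμ
  have hpos : ∀ P, memAmb μ s φ P → 0 < (P (Set.Ici r)).toReal := fun P hP =>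
    hc.trans_le (hcC P hP).1
  refine ⟨fun P hP => ⟨hpos P hP, ?_⟩, ?_⟩
  · have := hP.1
    exact opt_bdd hr0 hP.2.1
  set S := {y : ℝ | ∃ P : Measure ℝ, memAmb μ s φ P ∧ y = OPT P / REV r P} with hS
  set T := {y : ℝ | ∃ P : Measure ℝ, memAmb μ s φ P ∧ y = (P (Set.Ici r)).toReal} with hT
  set U := {y : ℝ | ∃ P : Measure ℝ, memAmb μ s φ P ∧
              y = (∫ x in Set.Ici r, x ∂P) / (P (Set.Ici r)).toReal} with hU
  -- a member
  obtain ⟨P₀, hP₀⟩ : ∃ P, memAmb μ s φ P := by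
    obtain ⟨x₂, hx, he⟩ := exists_upper (y := μ) (x₁ := μ - 1) hs hφ (by linarith)
      (by rw [hφ.zero]; simp; exact hs.le)
    obtain ⟨Q, hQ, -⟩ := exists_two_point (by linarith) hx he
    exact ⟨Q, hQ⟩
  have hTb : BddBelow T := ⟨c, by rintro _ ⟨P, hP, rfl⟩; exact (hcC P hP).1⟩
  have hTne : T.Nonempty := ⟨_, P₀, hP₀, rfl⟩
  have hTpos : 0 < sInf T := hc.trans_le
    (le_csInf hTne (by rintro _ ⟨P, hP, rfl⟩; exact (hcC P hP).1))
  have hUb : BddAbove U := by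
    refine ⟨C / c, ?_⟩
    rintro _ ⟨P, hP, rfl⟩
    have := hP.1
    have h1 := hpos P hP
    have h2 := tail_integral_lower (t := r) hP.2.1
    have h3 := hcC P hP
    have hC : 0 ≤ C := by nlinarith
    exact div_le_div₀ hC h3.2 hc h3.1
  have hUne : U.Nonempty := ⟨_, P₀, hP₀, rfl⟩
  have hSne : S.Nonempty := ⟨_, P₀, hP₀, rfl⟩
  have hub : ∀ y ∈ S, y ≤ max (1 / sInf T) ((1 / r) * sSup U) := by
    rintro _ ⟨P, hP, rfl⟩
    have := hP.1
    have hp := hpos P hP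
    have hle := opt_le hr0 hP.2.1
    have hR : 0 < REV r P := mul_pos hr0 hp
    rcases le_max_iff.1 hle with h | h
    · refine le_max_of_le_left ?_
      calc OPT P / REV r P ≤ r / REV r P := by gcongr
        _ = 1 / (P (Set.Ici r)).toReal := by unfold REV; field_simp
        _ ≤ _ := one_div_le_one_div_of_le hTpos (csInf_le hTb ⟨P, hP, rfl⟩)
    · refine le_max_of_le_right ?_
      calc OPT P / REV r P ≤ (∫ x in Set.Ici r, x ∂P) / REV r P := by gcongr
        _ = (1 / r) * ((∫ x in Set.Ici r, x ∂P) / (P (Set.Ici r)).toReal) := by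
            unfold REV; field_simp
        _ ≤ _ := by
            have := le_csSup hUb ⟨P, hP, rfl⟩
            gcongr
  have hSb : BddAbove S := ⟨_, hub⟩
  refine le_antisymm (csSup_le hSne hub) (max_le ?_ ?_)
  · -- tail probability
    have hSp : ∀ P, memAmb μ s φ P → 1 ≤ sSup S * (P (Set.Ici r)).toReal := by
      intro P hP
      have hp := hpos P hP
      obtain ⟨m₁, m₂, hm1, -, hmean, hdisp⟩ := collapse hs hφ hrμ hP hp
      have := hP.1
      have hp1 := prob_toReal_le_one (P := P) (Set.Ici r)
      set p := (P (Set.Ici r)).toReal with hpdef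
      have hstep : ∀ x₁, max m₁ 0 < x₁ → x₁ < r → x₁ / r ≤ sSup S * p := by
        intro x₁ hx hxr
        have hxm : m₁ < x₁ := (le_max_left _ _).trans_lt hx
        have hx0 : 0 < x₁ := (le_max_right _ _).trans_lt hx
        obtain ⟨y, hy⟩ : ∃ y, y = (μ - (1 - p) * x₁) / p := ⟨_, rfl⟩
        have hyp : p * y = μ - (1 - p) * x₁ := by rw [hy]; field_simp
        have hyμ : μ ≤ y := by
          by_contra! hcon
          nlinarith
        have hym : y ≤ m₂ := by
          by_contra! hcon
          nlinarith
        have hyx : p * (y - x₁) = μ - x₁ := by linarith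
        have hyx' : (1 - p) * (y - x₁) = y - μ := by linarith
        have hφ1 := hφ.anti hxm.le (hxr.trans hrμ).le
        have hφ2 := hφ.mono hyμ hym
        have hle : (1 - p) * φ x₁ + p * φ y ≤ s := by nlinarith
        obtain ⟨x₂, hx2, he⟩ := exists_upper (y := y) (x₁ := x₁) hs hφ (hxr.trans hrμ) (by
          rw [← hyx, ← hyx']
          have : 0 ≤ y - x₁ := by linarith
          nlinarith)
        obtain ⟨Q, hQ, hQt, hQ1⟩ := exists_two_point (hxr.trans hrμ) (hyμ.trans hx2) he
        have := hQ.1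
        have hQr := hQt r hxr (by linarith)
        have hOPT := le_opt hx0 hQ.2.1
        rw [hQ1, mul_one] at hOPT
        have hQp := hpos Q hQ
        have hQle : (Q (Set.Ici r)).toReal ≤ p := by
          rw [hQr, div_le_iff₀ (by linarith), ← hyx]
          gcongr
        have hmem : OPT Q / REV r Q ≤ sSup S := le_csSup hSb ⟨Q, hQ, rfl⟩
        have hRQ : 0 < REV r Q := mul_pos hr0 hQp
        have h7 : x₁ / (r * p) ≤ OPT Q / REV r Q := by
          have : REV r Q ≤ r * p := by unfold REV; gcongr
          exact div_le_div₀ (by linarith) hOPT hRQ this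
        have h8 : x₁ / r = x₁ / (r * p) * p := by field_simp
        rw [h8]
        gcongr
        exact h7.trans hmem
      by_contra! hcon
      have hlim : max (max m₁ 0) (r * (sSup S * p)) < r := by
        refine max_lt (max_lt hm1 hr0) ?_
        nlinarith
      obtain ⟨x₁, h1, h2⟩ := exists_between hlim
      have h3 := hstep x₁ ((le_max_left _ _).trans_lt h1) h2
      have h4 := (le_max_right _ _).trans_lt h1
      rw [div_le_iff₀ hr0] at h3
      linarith
    have hSpos : 0 < sSup S := by
      have := hSp P₀ hP₀
      have := hpos P₀ hP₀
      by_contra! hcon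
      nlinarith
    rw [one_div_le hTpos hSpos]
    refine le_csInf hTne ?_
    rintro _ ⟨P, hP, rfl⟩
    rw [div_le_iff₀ hSpos]
    linarith [hSp P hP]
  · -- conditional expectation
    rw [one_div, inv_mul_le_iff₀ hr0]
    refine csSup_le hUne ?_
    rintro _ ⟨P, hP, rfl⟩
    have hp := hpos P hP
    obtain ⟨m₁, m₂, hm1, hm2, hmean, hdisp⟩ := collapse hs hφ hrμ hP hp
    rw [← hm2]
    have := hP.1
    have hp1 := prob_toReal_le_one (P := P) (Set.Ici r)
    set p := (P (Set.Ici r)).toReal with hpdef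
    have hmμ : μ ≤ m₂ := by
      by_contra! hcon
      nlinarith
    have hyx : p * (m₂ - m₁) = μ - m₁ := by linarith
    have hyx' : (1 - p) * (m₂ - m₁) = m₂ - μ := by linarith
    obtain ⟨x₂, hx2, he⟩ := exists_upper (y := m₂) (x₁ := m₁) hs hφ (hm1.trans hrμ) (by
      rw [← hyx, ← hyx']
      have : 0 ≤ m₂ - m₁ := by linarith
      nlinarith)
    obtain ⟨Q, hQ, hQt, hQ1⟩ := exists_two_point (hm1.trans hrμ) (hmμ.trans hx2) he
    have := hQ.1
    have hQr := hQt r hm1 (by linarith)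
    have hQ2 := hQt x₂ (by linarith) le_rfl
    have hOPT := le_opt (t := x₂) (by linarith) hQ.2.1
    rw [hQ2, ← hQr] at hOPT
    have hQp := hpos Q hQ
    have hmem : OPT Q / REV r Q ≤ sSup S := le_csSup hSb ⟨Q, hQ, rfl⟩
    have hRQ : 0 < REV r Q := mul_pos hr0 hQp
    rw [div_le_iff₀ hRQ] at hmem
    unfold REV at hmem
    have h9 : x₂ * (Q (Set.Ici r)).toReal ≤ (r * sSup S) * (Q (Set.Ici r)).toReal := by linarith
    exact hx2.trans (le_of_mul_le_mul_right h9 hQp)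
end
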